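/- arXiv:1405.7923 — 2 statements merged into one kernel-verified Lean document; each statement's English description precedes it below -/
import Mathlib

section
/- Let L be an image-finite labelled transition system, let s, t be states of L and k ∈ ℕ. Then s ∼_k t if and only if there exists a sequence of sets of pairs of states {(s,t)} = B_0 ⊐ B_1 ⊐ B_2 ⊐ ⋯ ⊐ B_k (each B_{j+1} being a minimal expansion for B_j). -/
/-- A labelled transition system with states `S` and actions `A`. -/
structure LTS (S : Type*) (A : Type*) where
  Tr : A → S → S → Prop

namespace LTS

variable {S A : Type*}

/-- An LTS is image-finite if each state has finitely many `a`-successors. -/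
def ImageFinite (L : LTS S A) : Prop := ∀ a s, {t | L.Tr a s t}.Finite

/-- A set `B` of pairs of states covers the pair `p`. -/
def Covers (L : LTS S A) (B : Set (S × S)) (p : S × S) : Prop :=
  (∀ a s', L.Tr a p.1 s' → ∃ t', L.Tr a p.2 t' ∧ (s', t') ∈ B) ∧
  (∀ a t', L.Tr a p.2 t' → ∃ s', L.Tr a p.1 s' ∧ (s', t') ∈ B)

/-- `B'` covers the set `B` (i.e., covers each of its pairs). -/
def CoversSet (L : LTS S A) (B' B : Set (S × S)) : Prop := ∀ p ∈ B, L.Covers B' p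

/-- `B ⊐ B'`: `B'` is a minimal expansion for `B`. -/
def MinExp (L : LTS S A) (B B' : Set (S × S)) : Prop :=
  L.CoversSet B' B ∧ ∀ B'', B'' ⊂ B' → ¬ L.CoversSet B'' B

/-- The stratified equivalences: `∼_0` is everything, `∼_{k+1}` are the pairs covered by `∼_k`. -/
def simN (L : LTS S A) : ℕ → Set (S × S)
  | 0 => Set.univ
  | k + 1 => {p | L.Covers (L.simN k) p}

/-- `eqlevel(s,t) ∈ ℕ ∪ {ω}`: the largest `e` with `s ∼_e t` (`⊤` plays the role of `ω`,
meaning `s ∼_k t` for all `k ∈ ℕ`). -/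
noncomputable def eqlevel (L : LTS S A) (s t : S) : ℕ∞ :=
  sSup {e : ℕ∞ | ∃ k : ℕ, e = (k : ℕ∞) ∧ (s, t) ∈ L.simN k}

/-- `LeastEqLev(B) = min {eqlevel(s,t) | (s,t) ∈ B}`, with `min ∅ = ω = ⊤`. -/
noncomputable def leastEqLev (L : LTS S A) (B : Set (S × S)) : ℕ∞ :=
  sInf {e : ℕ∞ | ∃ p ∈ B, e = L.eqlevel p.1 p.2}

/-- `B` is a bisimulation if it covers itself. -/
def Bisimulation (L : LTS S A) (B : Set (S × S)) : Prop := L.CoversSet B B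

/-- `s ∼ t`: some bisimulation contains `(s,t)`. -/
def Bisim (L : LTS S A) (s t : S) : Prop := ∃ B, L.Bisimulation B ∧ (s, t) ∈ B

end LTS

/-- A finite set that meets every member of a nonempty chain of sets meets their intersection. -/
theorem IsChain.exists_mem_sInter_of_finite {X : Type*} {c : Set (Set X)}
    (hc : IsChain (· ⊆ ·) c) (hne : c.Nonempty) {T : Set X} (hT : T.Finite)
    (h : ∀ B ∈ c, ∃ x ∈ T, x ∈ B) : ∃ x ∈ T, x ∈ ⋂₀ c := by
  by_contra! hcon
  have key : ∃ B ∈ c, ∀ x ∈ T, x ∉ B := by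
    clear h
    induction T, hT using Set.Finite.induction_on with
    | empty => exact hne.imp fun B hB => ⟨hB, by simp⟩
    | @insert x T _ _ ih =>
      obtain ⟨B, hB, hBT⟩ := ih fun y hy => hcon y (Set.mem_insert_of_mem x hy)
      have hx := hcon x (Set.mem_insert x T)
      simp only [Set.mem_sInter, not_forall] at hx
      obtain ⟨B', hB', hxB'⟩ := hx
      rcases hc.total hB hB' with hle | hle
      · refine ⟨B, hB, ?_⟩
        rintro y (rfl | hy)
        · exact fun hyB => hxB' (hle hyB)
        · exact hBT y hy
      · refine ⟨B', hB', ?_⟩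
        rintro y (rfl | hy)
        · exact hxB'
        · exact fun hyB => hBT y hy (hle hyB)
  obtain ⟨B, hB, hBT⟩ := key
  obtain ⟨x, hx, hxB⟩ := h B hB
  exact hBT x hx hxB

namespace LTS

theorem Covers.mono {S A : Type*} {L : LTS S A} {B B' : Set (S × S)} {p : S × S}
    (h : L.Covers B p) (hB : B ⊆ B') : L.Covers B' p :=
  ⟨fun a s' hs => (h.1 a s' hs).imp fun _ ht => ⟨ht.1, hB ht.2⟩,
    fun a t' ht => (h.2 a t' ht).imp fun _ hs => ⟨hs.1, hB hs.2⟩⟩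

/-- In an image-finite LTS, covering is preserved by intersections of nonempty chains. -/
theorem ImageFinite.covers_sInter {S A : Type*} {L : LTS S A} (hfin : L.ImageFinite)
    {c : Set (Set (S × S))} (hc : IsChain (· ⊆ ·) c) (hne : c.Nonempty) {p : S × S}
    (h : ∀ B ∈ c, L.Covers B p) : L.Covers (⋂₀ c) p := by
  constructor
  · intro a s' hs
    obtain ⟨_, ⟨t', ht, rfl⟩, hmem⟩ := hc.exists_mem_sInter_of_finite hne
      ((hfin a p.2).image fun t' => (s', t')) fun B hB => by
        obtain ⟨t', ht, hB'⟩ := (h B hB).1 a s' hs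
        exact ⟨_, ⟨t', ht, rfl⟩, hB'⟩
    exact ⟨t', ht, hmem⟩
  · intro a t' ht
    obtain ⟨_, ⟨s', hs, rfl⟩, hmem⟩ := hc.exists_mem_sInter_of_finite hne
      ((hfin a p.1).image fun s' => (s', t')) fun B hB => by
        obtain ⟨s', hs, hB'⟩ := (h B hB).2 a t' ht
        exact ⟨_, ⟨s', hs, rfl⟩, hB'⟩
    exact ⟨s', hs, hmem⟩

/-- In an image-finite LTS, every covering set contains a minimal expansion. -/
theorem ImageFinite.exists_minExp_subset {S A : Type*} {L : LTS S A} (hfin : L.ImageFinite)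
    {B B' : Set (S × S)} (h : L.CoversSet B' B) : ∃ M ⊆ B', L.MinExp B M := by
  obtain ⟨M, hM, hmin⟩ := zorn_superset_nonempty {C | L.CoversSet C B}
    (fun c hcS hc hne => ⟨⋂₀ c,
      fun p hp => hfin.covers_sInter hc hne fun C hC => hcS hC p hp,
      fun _ hC => Set.sInter_subset_of_mem hC⟩) B' h
  exact ⟨M, hM, hmin.prop, fun C hC hCB => hC.2 (hmin.le_of_le hCB hC.1)⟩

theorem ImageFinite.subset_simN_iff {S A : Type*} {L : LTS S A} (hfin : L.ImageFinite)
    (k : ℕ) (B : Set (S × S)) :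
    B ⊆ L.simN k ↔
      ∃ Bs : ℕ → Set (S × S), Bs 0 = B ∧ ∀ j < k, L.MinExp (Bs j) (Bs (j + 1)) := by
  induction k generalizing B with
  | zero => exact ⟨fun _ => ⟨fun _ => B, rfl, by simp⟩, fun _ => Set.subset_univ B⟩
  | succ k ih =>
    constructor
    · intro h
      obtain ⟨M, hM, hmin⟩ := hfin.exists_minExp_subset (B' := L.simN k) fun _ hp => h hp
      obtain ⟨Bs, rfl, hBs⟩ := (ih M).1 hM
      refine ⟨fun n => Nat.casesOn n B Bs, rfl, ?_⟩
      rintro (_ | j) hj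
      · exact hmin
      · exact hBs j (Nat.lt_of_succ_lt_succ hj)
    · rintro ⟨Bs, rfl, hBs⟩ p hp
      have hsub : Bs 1 ⊆ L.simN k :=
        (ih (Bs 1)).2 ⟨fun n => Bs (n + 1), rfl, fun j hj => hBs (j + 1) (Nat.succ_lt_succ hj)⟩
      exact ((hBs 0 k.succ_pos).1 p hp).mono hsub

end LTS

/-- In an image-finite LTS, `s ∼_k t` iff there is a sequence
`{(s,t)} = B_0 ⊐ B_1 ⊐ ⋯ ⊐ B_k` of successive minimal expansions. -/
theorem simN_iff_min_expansion_seq {S A : Type*} (L : LTS S A)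
    (hfin : L.ImageFinite) (s t : S) (k : ℕ) :
    (s, t) ∈ L.simN k ↔
      ∃ Bs : ℕ → Set (S × S), Bs 0 = {(s, t)} ∧
        ∀ j < k, L.MinExp (Bs j) (Bs (j + 1)) := by
  rw [← Set.singleton_subset_iff]
  exact hfin.subset_simN_iff k {(s, t)}
end

section
/- Let G = (N, Act, R) be a first-order grammar. There is a total computable function which, given (codes of) a pair (T_0, U_0) of finite terms over N, returns eqlevel(T_0, U_0) ∈ ℕ ∪ {ω} (with ℕ ∪ {ω} suitably encoded) computed in the action-based LTS L^act_G. In particular, the bisimulation equivalence relation {(T_0,U_0) : T_0 ∼ U_0} on finite terms over N is decidable. -/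
/-- The "signature" of a first-order grammar: a finite set of ranked nonterminals
(represented as `Fin ntCount`, with arities) and a finite set of actions
(represented as `Fin actCount`). -/
structure GrammarSig where
  ntCount : ℕ
  arity : Fin ntCount → ℕ
  actCount : ℕ

/-- The polynomial functor whose coinductive fixed point is the set of (finite or
infinite) terms over the nonterminals: a node is labelled either by a nonterminal
`A` (with `arity A` ordered children) or by a variable `x_n`, `n : ℕ` (a leaf). -/
def GrammarSig.P (S : GrammarSig) : PFunctor :=
  ⟨Fin S.ntCount ⊕ ℕ, fun l =>
    match l with
    | Sum.inl A => Fin (S.arity A)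
    | Sum.inr _ => Empty⟩

/-- Terms over the signature `S`: finite or infinite ordered trees with nodes labelled
by nonterminals (inner nodes) or variables (leaves). -/
def GTerm (S : GrammarSig) := PFunctor.M S.P

/-- The term consisting of the single variable `x_n`. -/
def GTerm.var (S : GrammarSig) (n : ℕ) : GTerm S :=
  PFunctor.M.mk ⟨Sum.inr n, fun e => e.elim⟩

/-- The term `A(c 0, …, c (m-1))`. -/
def GTerm.app {S : GrammarSig} (A : Fin S.ntCount) (c : Fin (S.arity A) → GTerm S) :
    GTerm S :=
  PFunctor.M.mk ⟨Sum.inl A, c⟩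

/-- Applying a substitution `σ` to a term `T`: every occurrence of a variable `x_n`
in `T` is replaced by `σ n` (defined corecursively). -/
def GTerm.subst {S : GrammarSig} (σ : ℕ → GTerm S) (T : GTerm S) : GTerm S :=
  PFunctor.M.corec
    (fun st : Bool × GTerm S =>
      match PFunctor.M.dest st.2 with
      | ⟨Sum.inl A, c⟩ => ⟨Sum.inl A, fun i => (st.1, c i)⟩
      | ⟨Sum.inr n, _⟩ =>
        if st.1 then
          ⟨(PFunctor.M.dest (σ n)).1, fun i => (false, (PFunctor.M.dest (σ n)).2 i)⟩
        else ⟨Sum.inr n, fun e => e.elim⟩)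
    (true, T)

/-- A substitution (as a total map `ℕ → GTerm S`) has finite support. -/
def FinSupp {S : GrammarSig} (σ : ℕ → GTerm S) : Prop :=
  {n | σ n ≠ GTerm.var S n}.Finite

/-- `childRel S T T'`: `T'` is a root-successor (depth-1 subterm occurrence) of `T`. -/
def childRel (S : GrammarSig) : GTerm S → GTerm S → Prop := fun T T' =>
  ∃ (A : Fin S.ntCount) (c : Fin (S.arity A) → GTerm S), T = GTerm.app A c ∧ ∃ i, T' = c i

/-- `T'` is a subterm of `T`. -/
def SubtermOf (S : GrammarSig) (T' T : GTerm S) : Prop :=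
  Relation.ReflTransGen (childRel S) T T'

/-- The variable `x_n` occurs in `T`. -/
def VarOccurs (S : GrammarSig) (n : ℕ) (T : GTerm S) : Prop :=
  SubtermOf S (GTerm.var S n) T

/-- `OccAtDepth S d T V`: `V` has a subterm-occurrence in `T` at depth `d`. -/
inductive OccAtDepth (S : GrammarSig) : ℕ → GTerm S → GTerm S → Prop
  | refl (T : GTerm S) : OccAtDepth S 0 T T
  | step {d : ℕ} {T T' V : GTerm S} :
      childRel S T T' → OccAtDepth S d T' V → OccAtDepth S (d + 1) T V

/-- A term is regular if it has only finitely many distinct subterms. -/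
def RegularT (S : GrammarSig) (T : GTerm S) : Prop := {T' | SubtermOf S T' T}.Finite

/-- The presentation size of a (regular) term: the number of its distinct subterms. -/
noncomputable def pressize (S : GrammarSig) (T : GTerm S) : ℕ :=
  {T' | SubtermOf S T' T}.ncard

/-- Finite terms over the signature `S`. -/
inductive FTerm (S : GrammarSig) where
  | var : ℕ → FTerm S
  | app : (A : Fin S.ntCount) → (Fin (S.arity A) → FTerm S) → FTerm S

/-- The (finite or infinite) term corresponding to a finite term. -/
def FTerm.toTerm {S : GrammarSig} : FTerm S → GTerm S
  | .var n => GTerm.var S n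
  | .app A c => GTerm.app A (fun i => (c i).toTerm)

/-- The variable `x_n` occurs in the finite term `E`. -/
def FTerm.VOccurs {S : GrammarSig} (n : ℕ) : FTerm S → Prop
  | .var m => m = n
  | .app _ c => ∃ i, (c i).VOccurs n

/-- The depth of a finite term (the largest depth of a subterm occurrence). -/
def FTerm.depth {S : GrammarSig} : FTerm S → ℕ
  | .var _ => 0
  | .app _ c => Finset.univ.sup fun i => (c i).depth + 1

/-- A rule `A(x_0, …, x_{m−1}) →ₐ E` of a first-order grammar: `E` is a finite term
all of whose variables are among `x_0, …, x_{m−1}` where `m = arity A`. -/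
structure GRule (S : GrammarSig) where
  nt : Fin S.ntCount
  act : Fin S.actCount
  rhs : FTerm S
  rhs_wf : ∀ n : ℕ, rhs.VOccurs n → n < S.arity nt

/-- A first-order grammar: a signature together with a finite set (list) of rules. -/
structure FOGrammar where
  sig : GrammarSig
  rules : List (GRule sig)

/-- The term `A(x_0, …, x_{m−1})` (the left-hand side of rules for `A`). -/
def lhsTerm {S : GrammarSig} (A : Fin S.ntCount) : GTerm S :=
  GTerm.app A fun i => GTerm.var S i.val

/-- The rule-based LTS `L^rul_G`: states are the terms, actions are the rules of `G`,
and a rule `r : A(x_0,…,x_{m−1}) →ₐ E` induces `(A(x_0,…,x_{m−1}))σ →r Eσ` for every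
substitution `σ`. -/
def LTSrul (G : FOGrammar) : LTS (GTerm G.sig) (GRule G.sig) where
  Tr r T T' := r ∈ G.rules ∧ ∃ σ : ℕ → GTerm G.sig, FinSupp σ ∧
    T = GTerm.subst σ (lhsTerm r.nt) ∧ T' = GTerm.subst σ r.rhs.toTerm

/-- The action-based LTS `L^act_G`: the transitions of `L^rul_G` relabelled by the
actions of the rules; in addition each variable `x_n` has its own fresh action
(represented by `Sum.inr n`) with the single transition `x_n →_{a_{x_n}} x_n`. -/
def LTSact (G : FOGrammar) : LTS (GTerm G.sig) (Fin G.sig.actCount ⊕ ℕ) where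
  Tr a T T' :=
    match a with
    | Sum.inl a => ∃ r : GRule G.sig, r.act = a ∧ (LTSrul G).Tr r T T'
    | Sum.inr n => T = GTerm.var G.sig n ∧ T' = GTerm.var G.sig n

/-- `RPath G T w T'`: the path `T →w T'` in the rule-based LTS `L^rul_G`, `w ∈ R*`. -/
inductive RPath (G : FOGrammar) : GTerm G.sig → List (GRule G.sig) → GTerm G.sig → Prop
  | nil (T : GTerm G.sig) : RPath G T [] T
  | cons {T T1 T' : GTerm G.sig} {r : GRule G.sig} {w : List (GRule G.sig)} :
      (LTSrul G).Tr r T T1 → RPath G T1 w T' → RPath G T (r :: w) T'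

/-- `APath G T w T'`: the path `T →w T'` in the action-based LTS `L^act_G` for a word
`w ∈ Act*` of proper actions (using no special variable transitions). -/
inductive APath (G : FOGrammar) :
    GTerm G.sig → List (Fin G.sig.actCount) → GTerm G.sig → Prop
  | nil (T : GTerm G.sig) : APath G T [] T
  | cons {T T1 T' : GTerm G.sig} {a : Fin G.sig.actCount} {w : List (Fin G.sig.actCount)} :
      (LTSact G).Tr (Sum.inl a) T T1 → APath G T1 w T' → APath G T (a :: w) T'

/-- An (injective) encoding of finite terms by natural numbers. -/
def FTerm.enc {S : GrammarSig} : FTerm S → ℕ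
  | .var n => Nat.pair 0 n
  | .app A c =>
      Nat.pair 1 (Nat.pair A.val (Encodable.encode (List.ofFn fun i => (c i).enc)))

namespace GTerm

variable {S : GrammarSig}

theorem dest_var (n : ℕ) :
    PFunctor.M.dest (var S n) = ⟨Sum.inr n, fun e => e.elim⟩ := PFunctor.M.dest_mk _

theorem dest_app (A : Fin S.ntCount) (c : Fin (S.arity A) → GTerm S) :
    PFunctor.M.dest (app A c) = ⟨Sum.inl A, c⟩ := PFunctor.M.dest_mk _

theorem dest_injective {x y : GTerm S} (h : PFunctor.M.dest x = PFunctor.M.dest y) : x = y := by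
  rw [← PFunctor.M.mk_dest x, ← PFunctor.M.mk_dest y, h]

theorem var_or_app (T : GTerm S) : (∃ n, T = var S n) ∨ ∃ A c, T = app A c := by
  rcases h : PFunctor.M.dest T with ⟨A | n, c⟩
  · exact Or.inr ⟨A, c, dest_injective (h.trans (dest_app A c).symm)⟩
  · refine Or.inl ⟨n, dest_injective (h.trans ?_)⟩
    rw [dest_var]
    congr 1
    funext e
    exact e.elim

theorem var_inj {m n : ℕ} : var S m = var S n ↔ m = n := by
  refine ⟨fun h => ?_, fun h => h ▸ rfl⟩
  have h1 := congrArg Sigma.fst (congrArg PFunctor.M.dest h)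
  rw [dest_var, dest_var] at h1
  exact Sum.inr.inj h1

theorem app_inj {A : Fin S.ntCount} {c c' : Fin (S.arity A) → GTerm S} :
    app A c = app A c' ↔ c = c' := by
  refine ⟨fun h => ?_, fun h => h ▸ rfl⟩
  have h1 := congrArg PFunctor.M.dest h
  rw [dest_app, dest_app] at h1
  exact eq_of_heq (Sigma.mk.inj h1).2

theorem app_nt_inj {A B : Fin S.ntCount} {c : Fin (S.arity A) → GTerm S}
    {c' : Fin (S.arity B) → GTerm S} (h : app A c = app B c') : A = B := by
  have h1 := congrArg Sigma.fst (congrArg PFunctor.M.dest h)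
  rw [dest_app, dest_app] at h1
  exact Sum.inl.inj h1

theorem app_ne_var {A : Fin S.ntCount} {c : Fin (S.arity A) → GTerm S} {n : ℕ} :
    app A c ≠ var S n := by
  intro h
  have h1 := congrArg Sigma.fst (congrArg PFunctor.M.dest h)
  rw [dest_app, dest_var] at h1
  cases h1

theorem var_ne_app {A : Fin S.ntCount} {c : Fin (S.arity A) → GTerm S} {n : ℕ} :
    var S n ≠ app A c := app_ne_var.symm

/-- The term is a single variable. -/
def IsVar (T : GTerm S) : Prop := ∃ n, T = var S n

theorem not_isVar_app {A : Fin S.ntCount} {c : Fin (S.arity A) → GTerm S} :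
    ¬ IsVar (app A c) := fun ⟨_, h⟩ => app_ne_var h

theorem exists_app_of_not_isVar {T : GTerm S} (h : ¬ IsVar T) : ∃ A c, T = app A c :=
  (var_or_app T).resolve_left h

/-- Coinduction principle for equality of terms. -/
theorem eq_of_coind (R : GTerm S → GTerm S → Prop)
    (h : ∀ x y, R x y → x = y ∨ ∃ A c c', x = app A c ∧ y = app A c' ∧ ∀ i, R (c i) (c' i))
    {x y : GTerm S} (hxy : R x y) : x = y := by
  refine PFunctor.M.bisim (fun x y => R x y ∨ x = y) ?_ x y (Or.inl hxy)
  have key : ∀ x : GTerm S, ∃ a f f', PFunctor.M.dest x = ⟨a, f⟩ ∧ PFunctor.M.dest x = ⟨a, f'⟩ ∧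
      ∀ i, R (f i) (f' i) ∨ f i = f' i := fun x =>
    ⟨(PFunctor.M.dest x).1, (PFunctor.M.dest x).2, (PFunctor.M.dest x).2, rfl, rfl,
      fun _ => Or.inr rfl⟩
  rintro x y (hR | rfl)
  · rcases h x y hR with rfl | ⟨A, c, c', rfl, rfl, hc⟩
    · exact key x
    · exact ⟨Sum.inl A, c, c', dest_app A c, dest_app A c', fun i => Or.inl (hc i)⟩
  · exact key x

/-- Corecursive construction of a term. -/
def unfold {α : Type} (g : α → S.P α) (a : α) : GTerm S := PFunctor.M.corec g a

theorem unfold_app {α : Type} {g : α → S.P α} {a : α} {A : Fin S.ntCount}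
    {d : Fin (S.arity A) → α} (h : g a = ⟨Sum.inl A, d⟩) :
    unfold g a = app A fun i => unfold g (d i) := by
  refine dest_injective ((PFunctor.M.dest_corec g a).trans ?_)
  rw [h]
  exact (dest_app A _).symm

theorem unfold_var {α : Type} {g : α → S.P α} {a : α} {n : ℕ}
    {d : Empty → α} (h : g a = ⟨Sum.inr n, d⟩) : unfold g a = var S n := by
  refine dest_injective ((PFunctor.M.dest_corec g a).trans ?_)
  rw [h]
  refine Eq.trans ?_ (dest_var n).symm
  exact congrArg (Sigma.mk _) (funext fun e => Empty.elim e)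

theorem unfold_congr {α : Type} {g : α → S.P α} {a b : α} (h : g a = g b) :
    unfold g a = unfold g b := by
  refine dest_injective ((PFunctor.M.dest_corec g a).trans ?_)
  rw [h]
  exact (PFunctor.M.dest_corec g b).symm

/-- The corecursion step function used in `GTerm.subst`. -/
def substStep (σ : ℕ → GTerm S) (st : Bool × GTerm S) : S.P (Bool × GTerm S) :=
  match PFunctor.M.dest st.2 with
  | ⟨Sum.inl A, c⟩ => ⟨Sum.inl A, fun i => (st.1, c i)⟩
  | ⟨Sum.inr n, _⟩ =>
    if st.1 then
      ⟨(PFunctor.M.dest (σ n)).1, fun i => (false, (PFunctor.M.dest (σ n)).2 i)⟩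
    else ⟨Sum.inr n, fun e => e.elim⟩

theorem subst_eq_unfold (σ : ℕ → GTerm S) (T : GTerm S) :
    subst σ T = unfold (substStep σ) (true, T) := rfl

theorem substStep_app (σ : ℕ → GTerm S) (b : Bool) (A : Fin S.ntCount)
    (c : Fin (S.arity A) → GTerm S) :
    substStep σ (b, app A c) = ⟨Sum.inl A, fun i => (b, c i)⟩ := by
  simp only [substStep, dest_app]
  rfl

theorem unfold_substStep_false (σ : ℕ → GTerm S) (T : GTerm S) :
    unfold (substStep σ) (false, T) = T := by
  refine eq_of_coind (fun x y => x = unfold (substStep σ) (false, y)) ?_ rfl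
  rintro x y rfl
  rcases var_or_app y with ⟨n, rfl⟩ | ⟨A, c, rfl⟩
  · left
    refine unfold_var (d := fun e => e.elim) ?_
    simp only [substStep, dest_var]
    rfl
  · exact Or.inr ⟨A, _, c, unfold_app (substStep_app σ false A c), rfl, fun i => rfl⟩

theorem subst_app (σ : ℕ → GTerm S) (A : Fin S.ntCount) (c : Fin (S.arity A) → GTerm S) :
    subst σ (app A c) = app A fun i => subst σ (c i) :=
  unfold_app (substStep_app σ true A c)

theorem subst_var (σ : ℕ → GTerm S) (n : ℕ) : subst σ (var S n) = σ n := by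
  have h : substStep σ (true, var S n) =
      ⟨(PFunctor.M.dest (σ n)).1, fun i => (false, (PFunctor.M.dest (σ n)).2 i)⟩ := by
    simp only [substStep, dest_var]
    rfl
  rw [subst_eq_unfold]
  rcases var_or_app (σ n) with ⟨m, hm⟩ | ⟨A, c, hc⟩
  · rw [hm, dest_var] at h
    rw [unfold_var h, hm]
  · rw [hc, dest_app] at h
    rw [unfold_app h, hc]
    simp only [unfold_substStep_false]

theorem subst_subst (σ τ : ℕ → GTerm S) (T : GTerm S) :
    subst σ (subst τ T) = subst (fun n => subst σ (τ n)) T := by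
  refine eq_of_coind (fun x y => ∃ T, x = subst σ (subst τ T) ∧
    y = subst (fun n => subst σ (τ n)) T) ?_ ⟨T, rfl, rfl⟩
  rintro x y ⟨T, rfl, rfl⟩
  rcases var_or_app T with ⟨n, rfl⟩ | ⟨A, c, rfl⟩
  · left
    rw [subst_var, subst_var]
  · refine Or.inr ⟨A, _, _, ?_, subst_app _ _ _, fun i => ⟨c i, rfl, rfl⟩⟩
    rw [subst_app, subst_app]

theorem subst_id (T : GTerm S) : subst (var S) T = T := by
  refine eq_of_coind (fun x y => x = subst (var S) y) ?_ rfl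
  rintro x y rfl
  rcases var_or_app y with ⟨n, rfl⟩ | ⟨A, c, rfl⟩
  · exact Or.inl (subst_var _ _)
  · exact Or.inr ⟨A, _, c, subst_app _ _ _, rfl, fun i => rfl⟩

/-- Unfolding `x ↦ H` forever: for `H ≠ x` there is a term `M` with `M = H[x := M]`. -/
theorem exists_fixpoint (x : ℕ) (H : GTerm S) (hH : H ≠ var S x) :
    ∃ M, M = subst (Function.update (var S) x M) H := by
  classical
  let g : GTerm S → S.P (GTerm S) := fun T =>
    if T = var S x then PFunctor.M.dest H else PFunctor.M.dest T
  let f : GTerm S → GTerm S := unfold g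
  have happ : ∀ A c, f (app A c) = app A fun i => f (c i) := fun A c =>
    unfold_app ((if_neg app_ne_var).trans (dest_app A c))
  have hvar : f (var S x) = f H := unfold_congr ((if_pos rfl).trans (if_neg hH).symm)
  have hvar' : ∀ n, n ≠ x → f (var S n) = var S n := fun n hn =>
    unfold_var ((if_neg fun h => hn (var_inj.1 h)).trans (dest_var n))
  refine ⟨f H, ?_⟩
  have key : ∀ T, f T = subst (Function.update (var S) x (f H)) T := by
    intro T
    refine eq_of_coind (fun a b => ∃ T, a = f T ∧
      b = subst (Function.update (var S) x (f H)) T) ?_ ⟨T, rfl, rfl⟩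
    rintro a b ⟨T, rfl, rfl⟩
    rcases var_or_app T with ⟨n, rfl⟩ | ⟨A, c, rfl⟩
    · left
      rw [subst_var]
      by_cases hn : n = x
      · subst hn
        rw [Function.update_self, hvar]
      · rw [Function.update_of_ne hn, hvar' n hn]
    · exact Or.inr ⟨A, _, _, happ A c, subst_app _ _ _, fun i => ⟨c i, rfl, rfl⟩⟩
  exact key H

/-- The substitution `x_i ↦ c i` for `i < m`, the identity elsewhere. -/
def ext {m : ℕ} (c : Fin m → GTerm S) (n : ℕ) : GTerm S :=
  if h : n < m then c ⟨n, h⟩ else var S n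

theorem ext_of_lt {m : ℕ} (c : Fin m → GTerm S) {n : ℕ} (h : n < m) : ext c n = c ⟨n, h⟩ :=
  dif_pos h

theorem ext_val {m : ℕ} (c : Fin m → GTerm S) (i : Fin m) : ext c i.val = c i := dif_pos i.2

theorem subst_lhsTerm (σ : ℕ → GTerm S) (A : Fin S.ntCount) :
    subst σ (lhsTerm A) = app A fun i => σ i.val := by
  simp only [lhsTerm, subst_app, subst_var]

theorem subst_ext_lhsTerm (A : Fin S.ntCount) (c : Fin (S.arity A) → GTerm S) :
    subst (ext c) (lhsTerm A) = app A c := by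
  simp only [subst_lhsTerm, ext_val]

theorem subst_toTerm_congr (E : FTerm S) {σ τ : ℕ → GTerm S}
    (h : ∀ n, E.VOccurs n → σ n = τ n) : subst σ E.toTerm = subst τ E.toTerm := by
  induction E with
  | var n => simpa only [FTerm.toTerm, subst_var] using h n rfl
  | app A c ih =>
    simp only [FTerm.toTerm, subst_app, app_inj]
    funext i
    exact ih i fun n hn => h n ⟨i, hn⟩

end GTerm

/-- One step of the action `a` from the term `T` to the term `T'`, using a rule of `G`. -/
def StepA (G : FOGrammar) (a : Fin G.sig.actCount) (T T' : GTerm G.sig) : Prop :=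
  ∃ r ∈ G.rules, r.act = a ∧ ∃ c : Fin (G.sig.arity r.nt) → GTerm G.sig,
    T = GTerm.app r.nt c ∧ T' = GTerm.subst (GTerm.ext c) r.rhs.toTerm

theorem LTSact_inl_iff (G : FOGrammar) (a : Fin G.sig.actCount) (T T' : GTerm G.sig) :
    (LTSact G).Tr (Sum.inl a) T T' ↔ StepA G a T T' := by
  constructor
  · rintro ⟨r, ha, hr, σ, -, rfl, rfl⟩
    refine ⟨r, hr, ha, fun i => σ i.val, GTerm.subst_lhsTerm _ _, ?_⟩
    refine GTerm.subst_toTerm_congr _ fun n hn => ?_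
    rw [GTerm.ext_of_lt _ (r.rhs_wf n hn)]
  · rintro ⟨r, hr, ha, c, rfl, rfl⟩
    refine ⟨r, ha, hr, GTerm.ext c, ?_, (GTerm.subst_ext_lhsTerm _ _).symm, rfl⟩
    refine (Set.finite_lt_nat (G.sig.arity r.nt)).subset fun n hn => ?_
    by_contra h
    exact hn (dif_neg h)

theorem LTSact_inr_iff (G : FOGrammar) (n : ℕ) (T T' : GTerm G.sig) :
    (LTSact G).Tr (Sum.inr n) T T' ↔ T = GTerm.var G.sig n ∧ T' = GTerm.var G.sig n := Iff.rfl

/-- One step (by some rule) between terms. -/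
def Step (G : FOGrammar) (T T' : GTerm G.sig) : Prop := ∃ a, StepA G a T T'

/-- The stratified equivalence `∼_k` on terms. -/
def Sim (G : FOGrammar) (k : ℕ) (T U : GTerm G.sig) : Prop := (T, U) ∈ (LTSact G).simN k

/-- Exactly `l` rule steps lead from `T` to the second term. -/
inductive Reach (G : FOGrammar) (T : GTerm G.sig) : ℕ → GTerm G.sig → Prop
  | refl : Reach G T 0 T
  | tail {l : ℕ} {T' T'' : GTerm G.sig} : Reach G T l T' → Step G T' T'' → Reach G T (l + 1) T''

section Basic

variable {G : FOGrammar}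

open GTerm

theorem StepA.not_isVar {a : Fin G.sig.actCount} {T T' : GTerm G.sig} (h : StepA G a T T') :
    ¬ IsVar T := by
  obtain ⟨r, -, -, c, rfl, -⟩ := h
  exact not_isVar_app

theorem Step.not_isVar {T T' : GTerm G.sig} (h : Step G T T') : ¬ IsVar T := h.choose_spec.not_isVar

theorem StepA.subst {a : Fin G.sig.actCount} {E E' : GTerm G.sig} (h : StepA G a E E')
    (σ : ℕ → GTerm G.sig) : StepA G a (subst σ E) (subst σ E') := by
  obtain ⟨r, hr, ha, c, rfl, rfl⟩ := h
  refine ⟨r, hr, ha, fun i => GTerm.subst σ (c i), subst_app _ _ _, ?_⟩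
  rw [subst_subst]
  refine subst_toTerm_congr _ fun n hn => ?_
  rw [ext_of_lt _ (r.rhs_wf n hn), ext_of_lt _ (r.rhs_wf n hn)]

theorem StepA.subst_inv {a : Fin G.sig.actCount} {E X : GTerm G.sig} {σ : ℕ → GTerm G.sig}
    (hE : ¬ IsVar E) (h : StepA G a (GTerm.subst σ E) X) :
    ∃ E', StepA G a E E' ∧ X = GTerm.subst σ E' := by
  obtain ⟨A, c, rfl⟩ := exists_app_of_not_isVar hE
  obtain ⟨r, hr, ha, d, hd, rfl⟩ := h
  rw [subst_app] at hd
  obtain rfl := app_nt_inj hd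
  obtain rfl := app_inj.1 hd
  refine ⟨_, ⟨r, hr, ha, c, rfl, rfl⟩, ?_⟩
  rw [subst_subst]
  refine subst_toTerm_congr _ fun n hn => ?_
  rw [ext_of_lt _ (r.rhs_wf n hn), ext_of_lt _ (r.rhs_wf n hn)]

theorem Step.subst {E E' : GTerm G.sig} (h : Step G E E') (σ : ℕ → GTerm G.sig) :
    Step G (subst σ E) (subst σ E') := ⟨_, h.choose_spec.subst σ⟩

theorem Step.subst_inv {E X : GTerm G.sig} {σ : ℕ → GTerm G.sig}
    (hE : ¬ IsVar E) (h : Step G (GTerm.subst σ E) X) :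
    ∃ E', Step G E E' ∧ X = GTerm.subst σ E' := by
  obtain ⟨a, h⟩ := h
  obtain ⟨E', h1, h2⟩ := h.subst_inv hE
  exact ⟨E', ⟨a, h1⟩, h2⟩

theorem Reach.trans {T U V : GTerm G.sig} {k l : ℕ} (h : Reach G T k U) (h' : Reach G U l V) :
    Reach G T (k + l) V := by
  induction h' with
  | refl => exact h
  | tail _ hs ih => exact ih.tail hs

theorem Reach.single {T U : GTerm G.sig} (h : Step G T U) : Reach G T 1 U := Reach.refl.tail h

theorem Reach.head {T U V : GTerm G.sig} {l : ℕ} (h : Step G T U) (h' : Reach G U l V) :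
    Reach G T (l + 1) V := by
  rw [Nat.add_comm]
  exact (Reach.single h).trans h'

theorem Reach.succ_inv {T V : GTerm G.sig} {l : ℕ} (h : Reach G T (l + 1) V) :
    ∃ U, Step G T U ∧ Reach G U l V := by
  induction l generalizing V with
  | zero =>
    cases h with
    | tail h hs =>
      cases h
      exact ⟨V, hs, Reach.refl⟩
  | succ l ih =>
    cases h with
    | tail h hs =>
      obtain ⟨U, hU, hr⟩ := ih h
      exact ⟨U, hU, hr.tail hs⟩

theorem Reach.zero_inv {T V : GTerm G.sig} (h : Reach G T 0 V) : V = T := by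
  cases h
  rfl

theorem Reach.subst {E F : GTerm G.sig} {l : ℕ} (h : Reach G E l F) (σ : ℕ → GTerm G.sig) :
    Reach G (subst σ E) l (subst σ F) := by
  induction h with
  | refl => exact Reach.refl
  | tail _ hs ih => exact ih.tail (hs.subst σ)

theorem Reach.not_isVar {T U : GTerm G.sig} {l : ℕ} (h : Reach G T l U) (hl : l ≠ 0) :
    ¬ IsVar T := by
  obtain ⟨l, rfl⟩ := Nat.exists_eq_succ_of_ne_zero hl
  obtain ⟨_, hs, -⟩ := h.succ_inv
  exact hs.not_isVar

theorem Step.finite (T : GTerm G.sig) : {T' | Step G T T'}.Finite := by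
  classical
  have : {T' | Step G T T'} ⊆ ⋃ r ∈ {r | r ∈ G.rules},
      {T' | ∃ c, T = app r.nt c ∧ T' = GTerm.subst (ext c) r.rhs.toTerm} := by
    rintro T' ⟨a, r, hr, -, h⟩
    exact Set.mem_biUnion hr h
  refine Set.Finite.subset (Set.Finite.biUnion (List.finite_toSet G.rules) fun r _ => ?_) this
  refine Set.Subsingleton.finite ?_
  rintro _ ⟨c, rfl, rfl⟩ _ ⟨d, hd, rfl⟩
  rw [app_inj.1 hd]

theorem Reach.finite (T : GTerm G.sig) (l : ℕ) : {T' | Reach G T l T'}.Finite := by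
  induction l with
  | zero => exact (Set.finite_singleton T).subset fun T' h => h.zero_inv
  | succ l ih =>
    refine (ih.biUnion fun T' _ => Step.finite T').subset ?_
    rintro T'' h
    cases h with
    | tail h hs => exact Set.mem_biUnion h hs


theorem sim_zero (T U : GTerm G.sig) : Sim G 0 T U := trivial

theorem sim_succ_raw {k : ℕ} {T U : GTerm G.sig} :
    Sim G (k + 1) T U ↔ (LTSact G).Covers ((LTSact G).simN k) (T, U) := Iff.rfl

theorem Sim.refl (k : ℕ) (T : GTerm G.sig) : Sim G k T T := by
  induction k generalizing T with
  | zero => trivial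
  | succ k ih => exact ⟨fun a s h => ⟨s, h, ih s⟩, fun a s h => ⟨s, h, ih s⟩⟩

theorem Sim.symm {k : ℕ} {T U : GTerm G.sig} (h : Sim G k T U) : Sim G k U T := by
  induction k generalizing T U with
  | zero => trivial
  | succ k ih =>
    refine ⟨fun a s hs => ?_, fun a s hs => ?_⟩
    · obtain ⟨t, ht, h'⟩ := h.2 a s hs
      exact ⟨t, ht, ih h'⟩
    · obtain ⟨t, ht, h'⟩ := h.1 a s hs
      exact ⟨t, ht, ih h'⟩

theorem Sim.trans {k : ℕ} {T U V : GTerm G.sig} (h : Sim G k T U) (h' : Sim G k U V) :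
    Sim G k T V := by
  induction k generalizing T U V with
  | zero => trivial
  | succ k ih =>
    refine ⟨fun a s hs => ?_, fun a s hs => ?_⟩
    · obtain ⟨t, ht, h1⟩ := h.1 a s hs
      obtain ⟨u, hu, h2⟩ := h'.1 a t ht
      exact ⟨u, hu, ih h1 h2⟩
    · obtain ⟨t, ht, h1⟩ := h'.2 a s hs
      obtain ⟨u, hu, h2⟩ := h.2 a t ht
      exact ⟨u, hu, ih h2 h1⟩

theorem Sim.of_succ {k : ℕ} {T U : GTerm G.sig} (h : Sim G (k + 1) T U) : Sim G k T U := by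
  induction k generalizing T U with
  | zero => trivial
  | succ k ih =>
    refine ⟨fun a s hs => ?_, fun a s hs => ?_⟩
    · obtain ⟨t, ht, h'⟩ := h.1 a s hs
      exact ⟨t, ht, ih h'⟩
    · obtain ⟨t, ht, h'⟩ := h.2 a s hs
      exact ⟨t, ht, ih h'⟩

theorem Sim.mono {k l : ℕ} (hkl : k ≤ l) {T U : GTerm G.sig} (h : Sim G l T U) : Sim G k T U := by
  induction hkl with
  | refl => exact h
  | step _ ih => exact ih h.of_succ

theorem sim_succ_iff {k : ℕ} {T U : GTerm G.sig} :
    Sim G (k + 1) T U ↔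
      (∀ a T', StepA G a T T' → ∃ U', StepA G a U U' ∧ Sim G k T' U') ∧
      (∀ a U', StepA G a U U' → ∃ T', StepA G a T T' ∧ Sim G k T' U') ∧
      ∀ n, T = var G.sig n ↔ U = var G.sig n := by
  constructor
  · intro h
    refine ⟨fun a T' hT => ?_, fun a U' hU => ?_, fun n => ⟨fun hT => ?_, fun hU => ?_⟩⟩
    · obtain ⟨U', hU, h'⟩ := h.1 (Sum.inl a) T' ((LTSact_inl_iff ..).2 hT)
      exact ⟨U', (LTSact_inl_iff ..).1 hU, h'⟩
    · obtain ⟨T', hT, h'⟩ := h.2 (Sum.inl a) U' ((LTSact_inl_iff ..).2 hU)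
      exact ⟨T', (LTSact_inl_iff ..).1 hT, h'⟩
    · obtain ⟨_, hU, -⟩ := h.1 (Sum.inr n) (var G.sig n) ⟨hT, rfl⟩
      exact hU.1
    · obtain ⟨_, hT, -⟩ := h.2 (Sum.inr n) (var G.sig n) ⟨hU, rfl⟩
      exact hT.1
  · rintro ⟨h1, h2, h3⟩
    refine ⟨?_, ?_⟩
    · rintro (a | n) s hs
      · obtain ⟨t, ht, h'⟩ := h1 a s ((LTSact_inl_iff ..).1 hs)
        exact ⟨t, (LTSact_inl_iff ..).2 ht, h'⟩
      · obtain ⟨hT, rfl⟩ := hs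
        exact ⟨_, ⟨(h3 n).1 hT, rfl⟩, Sim.refl _ _⟩
    · rintro (a | n) s hs
      · obtain ⟨t, ht, h'⟩ := h2 a s ((LTSact_inl_iff ..).1 hs)
        exact ⟨t, (LTSact_inl_iff ..).2 ht, h'⟩
      · obtain ⟨hU, rfl⟩ := hs
        exact ⟨_, ⟨(h3 n).2 hU, rfl⟩, Sim.refl _ _⟩

theorem Sim.reach {k l : ℕ} {T U T' : GTerm G.sig} (h : Sim G k T U) (hr : Reach G T l T')
    (hl : l ≤ k) : ∃ U', Reach G U l U' ∧ Sim G (k - l) T' U' := by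
  induction hr with
  | refl => exact ⟨U, Reach.refl, h⟩
  | @tail l T' T'' _ hs ih =>
    obtain ⟨U', hU', h'⟩ := ih (by omega)
    obtain ⟨a, hs⟩ := hs
    obtain ⟨d, hd⟩ : ∃ d, k - l = d + 1 := ⟨k - l - 1, by omega⟩
    rw [hd] at h'
    obtain ⟨U'', hs', h''⟩ := (sim_succ_iff.1 h').1 a T'' hs
    exact ⟨U'', hU'.tail ⟨a, hs'⟩, h''.mono (by omega)⟩

/-- Two instances of `E` are `∼_k` as soon as the substitutions are sufficiently equivalent at
the variables that `E` can expose within `k` steps. -/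
theorem sim_subst_of_reach {k : ℕ} {E : GTerm G.sig} {σ τ : ℕ → GTerm G.sig}
    (h : ∀ l ≤ k, ∀ x, Reach G E l (var G.sig x) → Sim G (k - l) (σ x) (τ x)) :
    Sim G k (subst σ E) (subst τ E) := by
  induction k generalizing E with
  | zero => exact sim_zero _ _
  | succ k ih =>
    rcases var_or_app E with ⟨n, rfl⟩ | ⟨A, c, rfl⟩
    · simpa only [subst_var, Nat.sub_zero] using h 0 (Nat.zero_le _) n Reach.refl
    · have key : ∀ a E', StepA G a (app A c) E' → Sim G k (subst σ E') (subst τ E') := by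
        intro a E' hE'
        refine ih fun l hl x hx => ?_
        have := h (l + 1) (by omega) x (Reach.head ⟨a, hE'⟩ hx)
        exact this.mono (by omega)
      rw [sim_succ_iff]
      refine ⟨fun a T' hT => ?_, fun a U' hU => ?_, fun n => ?_⟩
      · obtain ⟨E', hE', rfl⟩ := hT.subst_inv not_isVar_app
        exact ⟨_, hE'.subst τ, key a E' hE'⟩
      · obtain ⟨E', hE', rfl⟩ := hU.subst_inv not_isVar_app
        exact ⟨_, hE'.subst σ, key a E' hE'⟩
      · rw [subst_app, subst_app]
        exact ⟨fun h => absurd h app_ne_var, fun h => absurd h app_ne_var⟩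

theorem Sim.subst_right {k : ℕ} {σ τ : ℕ → GTerm G.sig} (h : ∀ x, Sim G k (σ x) (τ x))
    (E : GTerm G.sig) : Sim G k (GTerm.subst σ E) (GTerm.subst τ E) :=
  sim_subst_of_reach fun _ _ x _ => (h x).mono (Nat.sub_le _ _)

theorem Sim.subst {k : ℕ} {E F : GTerm G.sig} (h : Sim G k E F) (σ : ℕ → GTerm G.sig) :
    Sim G k (GTerm.subst σ E) (GTerm.subst σ F) := by
  induction k generalizing E F with
  | zero => exact sim_zero _ _
  | succ k ih =>
    obtain ⟨h1, h2, h3⟩ := sim_succ_iff.1 h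
    rcases var_or_app E with ⟨n, rfl⟩ | ⟨A, c, rfl⟩
    · rw [(h3 n).1 rfl]
      exact Sim.refl _ _
    rcases var_or_app F with ⟨n, rfl⟩ | ⟨B, d, rfl⟩
    · exact absurd ((h3 n).2 rfl) app_ne_var
    rw [sim_succ_iff]
    refine ⟨fun a T' hT => ?_, fun a U' hU => ?_, fun n => ?_⟩
    · obtain ⟨E', hE', rfl⟩ := hT.subst_inv not_isVar_app
      obtain ⟨F', hF', h'⟩ := h1 a E' hE'
      exact ⟨_, hF'.subst σ, ih h'⟩
    · obtain ⟨F', hF', rfl⟩ := hU.subst_inv not_isVar_app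
      obtain ⟨E', hE', h'⟩ := h2 a F' hF'
      exact ⟨_, hE'.subst σ, ih h'⟩
    · rw [subst_app, subst_app]
      exact ⟨fun h => absurd h app_ne_var, fun h => absurd h app_ne_var⟩

/-- If `E, F` are distinguished in `k + 1` steps while `Eσ, Fσ` are not, then some matching
plays of length at most `k` end in a variable on one side and in another term on the other. -/
theorem exists_exposed_var {k d : ℕ} {E F : GTerm G.sig} {σ : ℕ → GTerm G.sig}
    (hn : ¬ Sim G (k + 1) E F) (h : Sim G (k + 1 + d) (subst σ E) (subst σ F)) :
    ∃ l ≤ k, ∃ E' F', Reach G E l E' ∧ Reach G F l F' ∧ E' ≠ F' ∧ (IsVar E' ∨ IsVar F') ∧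
      Sim G (d + 1) (subst σ E') (subst σ F') := by
  induction k generalizing E F with
  | zero =>
    have hEF : E ≠ F := fun h => hn (h ▸ Sim.refl _ _)
    by_cases hv : IsVar E ∨ IsVar F
    · exact ⟨0, le_rfl, E, F, Reach.refl, Reach.refl, hEF, hv, h.mono (by omega)⟩
    · rw [not_or] at hv
      exfalso
      apply hn
      have h1 := sim_succ_iff.1 (h.mono (show 0 + 1 ≤ 0 + 1 + d by omega))
      rw [sim_succ_iff]
      refine ⟨fun a T' hT => ?_, fun a U' hU => ?_, fun n => ?_⟩
      · obtain ⟨X, hX, -⟩ := h1.1 a _ (hT.subst σ)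
        obtain ⟨F', hF', -⟩ := hX.subst_inv hv.2
        exact ⟨F', hF', sim_zero _ _⟩
      · obtain ⟨X, hX, -⟩ := h1.2.1 a _ (hU.subst σ)
        obtain ⟨F', hF', -⟩ := hX.subst_inv hv.1
        exact ⟨F', hF', sim_zero _ _⟩
      · exact ⟨fun h => absurd ⟨n, h⟩ hv.1, fun h => absurd ⟨n, h⟩ hv.2⟩
  | succ k ih =>
    have hEF : E ≠ F := fun h => hn (h ▸ Sim.refl _ _)
    by_cases hv : IsVar E ∨ IsVar F
    · exact ⟨0, Nat.zero_le _, E, F, Reach.refl, Reach.refl, hEF, hv, h.mono (by omega)⟩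
    rw [not_or] at hv
    have h1 := sim_succ_iff.1 (h.mono (show (k + 1 + d) + 1 ≤ k + 1 + 1 + d by omega))
    by_contra hcon
    apply hn
    have key : ∀ E' F', Step G E E' → Step G F F' →
        Sim G (k + 1 + d) (subst σ E') (subst σ F') → Sim G (k + 1) E' F' := by
      intro E' F' hE hF hs
      by_contra hns
      obtain ⟨l, hl, E'', F'', hE'', hF'', hr⟩ := ih hns hs
      exact hcon ⟨l + 1, by omega, E'', F'', hE''.head hE, hF''.head hF, hr⟩
    rw [sim_succ_iff]
    refine ⟨fun a T' hT => ?_, fun a U' hU => ?_, fun n => ?_⟩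
    · obtain ⟨X, hX, hs⟩ := h1.1 a _ (hT.subst σ)
      obtain ⟨F', hF', rfl⟩ := hX.subst_inv hv.2
      exact ⟨F', hF', key _ _ ⟨a, hT⟩ ⟨a, hF'⟩ hs⟩
    · obtain ⟨X, hX, hs⟩ := h1.2.1 a _ (hU.subst σ)
      obtain ⟨F', hF', rfl⟩ := hX.subst_inv hv.1
      exact ⟨F', hF', key _ _ ⟨a, hF'⟩ ⟨a, hU⟩ hs⟩
    · exact ⟨fun h => absurd ⟨n, h⟩ hv.1, fun h => absurd ⟨n, h⟩ hv.2⟩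

/-- The terms `T`, `U` have the finite equivalence level `e`. -/
def EqLev (G : FOGrammar) (e : ℕ) (T U : GTerm G.sig) : Prop := Sim G e T U ∧ ¬ Sim G (e + 1) T U

theorem EqLev.symm {e : ℕ} {T U : GTerm G.sig} (h : EqLev G e T U) : EqLev G e U T :=
  ⟨h.1.symm, fun h' => h.2 h'.symm⟩

theorem EqLev.le_of_not_sim {e k : ℕ} {T U : GTerm G.sig} (h : EqLev G e T U)
    (h' : ¬ Sim G (k + 1) T U) : e ≤ k := by
  by_contra hlt
  exact h' (h.1.mono (by omega))

theorem EqLev.unique {e k : ℕ} {T U : GTerm G.sig} (h : EqLev G e T U) (h' : EqLev G k T U) :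
    e = k := le_antisymm (h.le_of_not_sim h'.2) (h'.le_of_not_sim h.2)

theorem exists_eqLev {k : ℕ} {T U : GTerm G.sig} (h : ¬ Sim G k T U) : ∃ e, EqLev G e T U := by
  induction k with
  | zero => exact absurd (sim_zero T U) h
  | succ k ih =>
    by_cases hk : Sim G k T U
    · exact ⟨k, hk, h⟩
    · exact ih hk

theorem EqLev.congr {e : ℕ} {T U T' U' : GTerm G.sig} (h : EqLev G e T U)
    (hT : Sim G (e + 1) T T') (hU : Sim G (e + 1) U U') : EqLev G e T' U' :=
  ⟨(hT.of_succ.symm.trans h.1).trans hU.of_succ,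
    fun h' => h.2 ((hT.trans h').trans hU.symm)⟩

theorem EqLev.step {e : ℕ} {T U : GTerm G.sig} (h : EqLev G (e + 1) T U) :
    ∃ T' U', Step G T T' ∧ Step G U U' ∧ EqLev G e T' U' := by
  obtain ⟨h1, h2, h3⟩ := sim_succ_iff.1 h.1
  have hn := h.2
  by_contra hcon
  apply hn
  rw [sim_succ_iff]
  have key : ∀ T' U', Step G T T' → Step G U U' → Sim G e T' U' → Sim G (e + 1) T' U' := by
    intro T' U' hT hU hs
    by_contra hns
    exact hcon ⟨T', U', hT, hU, hs, hns⟩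
  refine ⟨fun a T' hT => ?_, fun a U' hU => ?_, h3⟩
  · obtain ⟨U', hU, hs⟩ := h1 a T' hT
    exact ⟨U', hU, key _ _ ⟨a, hT⟩ ⟨a, hU⟩ hs⟩
  · obtain ⟨T', hT, hs⟩ := h2 a U' hU
    exact ⟨T', hT, key _ _ ⟨a, hT⟩ ⟨a, hU⟩ hs⟩

end Basic

section Sequence

open GTerm

variable {G : FOGrammar}

/-- `Long G σ P n e`: there are `p₀ ∈ P 0, …, p_{n-1} ∈ P (n-1)` such that the instances of these
pairs under `σ` have strictly decreasing equivalence levels, all of them below `e`. -/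
def Long (G : FOGrammar) (σ : ℕ → GTerm G.sig) :
    (P : ℕ → Set (GTerm G.sig × GTerm G.sig)) → (n e : ℕ) → Prop
  | _, 0, _ => True
  | P, n + 1, e => ∃ p ∈ P 0, ∃ e' < e, EqLev G e' (subst σ p.1) (subst σ p.2) ∧
      Long G σ (fun j => P (j + 1)) n e'

theorem Long.mono {σ : ℕ → GTerm G.sig} {P : ℕ → Set (GTerm G.sig × GTerm G.sig)} {n e e' : ℕ}
    (h : Long G σ P n e) (hle : e ≤ e') : Long G σ P n e' := by
  cases n with
  | zero => trivial
  | succ n =>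
    obtain ⟨p, hp, f, hf, h1, h2⟩ := h
    exact ⟨p, hp, f, by omega, h1, h2⟩

theorem Long.anti {σ : ℕ → GTerm G.sig} {P : ℕ → Set (GTerm G.sig × GTerm G.sig)} {n n' e : ℕ}
    (h : Long G σ P n e) (hle : n' ≤ n) : Long G σ P n' e := by
  induction n' generalizing P n e with
  | zero => trivial
  | succ n' ih =>
    obtain ⟨n, rfl⟩ : ∃ k, n = k + 1 := ⟨n - 1, by omega⟩
    obtain ⟨p, hp, f, hf, h1, h2⟩ := h
    exact ⟨p, hp, f, hf, h1, ih h2 (by omega)⟩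

theorem Long.le {σ : ℕ → GTerm G.sig} {P : ℕ → Set (GTerm G.sig × GTerm G.sig)} {n e : ℕ}
    (h : Long G σ P n e) : n ≤ e := by
  induction n generalizing P e with
  | zero => omega
  | succ n ih =>
    obtain ⟨p, hp, f, hf, h1, h2⟩ := h
    have := ih h2
    omega

theorem Long.drop {σ : ℕ → GTerm G.sig} {P : ℕ → Set (GTerm G.sig × GTerm G.sig)} {n d e : ℕ}
    (h : Long G σ P (n + d) e) : ∃ e', e' + d ≤ e ∧ Long G σ (fun j => P (j + d)) n e' := by
  induction d generalizing P e with
  | zero => exact ⟨e, le_rfl, h⟩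
  | succ d ih =>
    obtain ⟨p, hp, f, hf, h1, h2⟩ := h
    obtain ⟨e', he', h'⟩ := ih h2
    exact ⟨e', by omega, h'⟩

theorem Long.map {σ σ' : ℕ → GTerm G.sig} {P : ℕ → Set (GTerm G.sig × GTerm G.sig)} {n e m : ℕ}
    {φ : GTerm G.sig → GTerm G.sig} (h : Long G σ P n e) (hem : e ≤ m)
    (hφ : ∀ E, Sim G m (subst σ E) (subst σ' (φ E))) :
    Long G σ' (fun j => Prod.map φ φ '' P j) n e := by
  induction n generalizing P e with
  | zero => trivial
  | succ n ih =>
    obtain ⟨p, hp, f, hf, h1, h2⟩ := h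
    exact ⟨_, ⟨p, hp, rfl⟩, f, hf, h1.congr ((hφ _).mono (by omega)) ((hφ _).mono (by omega)),
      ih h2 (by omega)⟩

theorem exists_uniform {α : Type*} {s : Set α} (hs : s.Finite) {Q : α → ℕ → Prop}
    (hm : ∀ a m n, m ≤ n → Q a m → Q a n) (h : ∀ a ∈ s, ∃ n, Q a n) :
    ∃ n, ∀ a ∈ s, Q a n := by
  classical
  choose! f hf using h
  obtain ⟨N, hN⟩ := (hs.image f).bddAbove
  exact ⟨N, fun a ha => hm a _ _ (hN ⟨a, ha, rfl⟩) (hf a ha)⟩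

theorem exists_eqLev_bound {s : Set (GTerm G.sig × GTerm G.sig)} (hs : s.Finite) :
    ∃ K, ∀ p ∈ s, ∀ k, EqLev G k p.1 p.2 → k ≤ K := by
  refine exists_uniform hs (fun _ m n hmn h k hk => (h k hk).trans hmn) fun p _ => ?_
  by_cases h : ∃ k, EqLev G k p.1 p.2
  · obtain ⟨k, hk⟩ := h
    exact ⟨k, fun j hj => (hj.unique hk).le⟩
  · exact ⟨0, fun j hj => absurd ⟨j, hj⟩ h⟩

theorem exists_var_in_support {X : Finset ℕ} {σ : ℕ → GTerm G.sig}
    (hσ : ∀ n, n ∉ X → σ n = var G.sig n) {x d : ℕ} {F : GTerm G.sig} (hF : F ≠ var G.sig x)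
    (h : Sim G (d + 1) (σ x) (subst σ F)) :
    ∃ y ∈ X, ∃ H, (H = var G.sig x ∨ H = F) ∧ H ≠ var G.sig y ∧
      Sim G (d + 1) (σ y) (subst σ H) := by
  by_cases hx : x ∈ X
  · exact ⟨x, hx, F, Or.inr rfl, hF, h⟩
  · rw [hσ x hx] at h
    have h1 := ((sim_succ_iff.1 h).2.2 x).1 rfl
    rcases var_or_app F with ⟨y, rfl⟩ | ⟨A, c, rfl⟩
    · refine ⟨y, ?_, var G.sig x, Or.inl rfl, fun h => hF h.symm, ?_⟩
      · by_contra hy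
        rw [subst_var, hσ y hy] at h1
        exact hF h1
      · rw [subst_var] at h1 ⊢
        rw [hσ x hx, h1]
        exact Sim.refl _ _
    · rw [subst_app] at h1
      exact absurd h1 app_ne_var

/-- A substitution solving `x ≈ H` may be replaced by one eliminating `x`. -/
theorem sim_eliminate {σ : ℕ → GTerm G.sig} {x m : ℕ} {H M : GTerm G.sig}
    (hH : H ≠ var G.sig x) (h : Sim G m (σ x) (subst σ H))
    (hM : M = subst (Function.update (var G.sig) x M) H) (E : GTerm G.sig) :
    Sim G m (subst σ E) (subst (Function.update σ x (var G.sig x))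
      (subst (Function.update (var G.sig) x M) E)) := by
  obtain ⟨R, hR⟩ : ∃ R, R = subst (Function.update σ x (var G.sig x)) M := ⟨_, rfl⟩
  have key : ∀ E, subst (Function.update σ x (var G.sig x))
      (subst (Function.update (var G.sig) x M) E) = subst (Function.update σ x R) E := by
    intro E
    rw [subst_subst]
    congr 1
    funext n
    by_cases hn : n = x
    · subst hn
      rw [Function.update_self, Function.update_self, hR]
    · rw [Function.update_of_ne hn, Function.update_of_ne hn, subst_var, Function.update_of_ne hn]
  have hRH : R = subst (Function.update σ x R) H := by rw [← key, ← hM, hR]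
  have hj : ∀ j ≤ m, Sim G j (σ x) R := by
    intro j
    induction j with
    | zero => exact fun _ => sim_zero _ _
    | succ j ih =>
      intro hjm
      rw [hRH]
      refine (h.mono hjm).trans (sim_subst_of_reach fun l hl y hy => ?_)
      by_cases hyx : y = x
      · subst hyx
        rw [Function.update_self]
        have hl0 : l ≠ 0 := by
          rintro rfl
          exact hH hy.zero_inv.symm
        exact (ih (by omega)).mono (by omega)
      · rw [Function.update_of_ne hyx]
        exact Sim.refl _ _
  rw [key]
  refine Sim.subst_right (fun y => ?_) E
  by_cases hyx : y = x
  · subst hyx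
    rw [Function.update_self]
    exact hj m le_rfl
  · rw [Function.update_of_ne hyx]
    exact Sim.refl _ _

/-- The length of chains with decreasing equivalence levels obtained by instantiating pairs from a
sequence of finite sets by one substitution with support in `X` is bounded independently of the
substitution. -/
theorem exists_long_bound (X : Finset ℕ) (P : ℕ → Set (GTerm G.sig × GTerm G.sig))
    (hP : ∀ j, (P j).Finite) :
    ∃ L, ∀ σ : ℕ → GTerm G.sig, (∀ n, n ∉ X → σ n = var G.sig n) → ∀ e, ¬ Long G σ P L e := by
  classical
  induction hc : X.card generalizing X P with
  | zero =>
    obtain ⟨K, hK⟩ := exists_eqLev_bound (hP 0)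
    refine ⟨K + 2, fun σ hσ e h => ?_⟩
    have hid : σ = var G.sig := by
      funext n
      exact hσ n (by rw [Finset.card_eq_zero.1 hc]; exact Finset.notMem_empty _)
    subst hid
    obtain ⟨p, hp, f, hf, h1, h2⟩ := h
    rw [subst_id, subst_id] at h1
    have := hK p hp f h1
    have := h2.le
    omega
  | succ c ih =>
    obtain ⟨K, hK⟩ := exists_eqLev_bound (hP 0)
    have hHs : {H | ∃ p ∈ P 0, ∃ l ≤ K, Reach G p.1 l H ∨ Reach G p.2 l H}.Finite := by
      have : {H | ∃ p ∈ P 0, ∃ l ≤ K, Reach G p.1 l H ∨ Reach G p.2 l H} =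
          ⋃ p ∈ P 0, ⋃ l ∈ Set.Iic K, ({H | Reach G p.1 l H} ∪ {H | Reach G p.2 l H}) := by
        ext H
        simp
      rw [this]
      exact (hP 0).biUnion fun p _ => (Set.finite_Iic K).biUnion fun l _ =>
        (Reach.finite _ _).union (Reach.finite _ _)
    obtain ⟨L, hL⟩ := exists_uniform (X.finite_toSet.prod hHs)
      (Q := fun q L => q.2 ≠ var G.sig q.1 →
        ∃ M, M = subst (Function.update (var G.sig) q.1 M) q.2 ∧
          ∀ σ : ℕ → GTerm G.sig, (∀ n, n ∉ X.erase q.1 → σ n = var G.sig n) →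
            ∀ e, ¬ Long G σ (fun j => Prod.map (subst (Function.update (var G.sig) q.1 M))
              (subst (Function.update (var G.sig) q.1 M)) '' P (j + K + 1)) L e)
      (fun q m n hmn h hq => by
        obtain ⟨M, hM, h⟩ := h hq
        exact ⟨M, hM, fun σ hσ e hl => h σ hσ e (hl.anti hmn)⟩)
      (fun q hq => by
        by_cases hne : q.2 = var G.sig q.1
        · exact ⟨0, fun h => absurd hne h⟩
        obtain ⟨M, hM⟩ := exists_fixpoint q.1 q.2 hne
        have hcard : (X.erase q.1).card = c := by
          rw [Finset.card_erase_of_mem (by simpa using hq.1), hc]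
          rfl
        obtain ⟨L, hL⟩ := ih (X.erase q.1)
          (fun j => Prod.map (subst (Function.update (var G.sig) q.1 M))
              (subst (Function.update (var G.sig) q.1 M)) '' P (j + K + 1))
          (fun j => (hP _).image _) hcard
        exact ⟨L, fun _ => ⟨M, hM, hL⟩⟩)
    refine ⟨L + K + 2, fun σ hσ e h => ?_⟩
    obtain ⟨p, hp, e1, -, h1, h2⟩ := h
    have hKe : K + 1 ≤ e1 := by
      have : L + K + 1 ≤ e1 := h2.le
      omega
    have hn : ¬ Sim G (e1 + 1) p.1 p.2 := fun hs => h1.2 (hs.subst σ)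
    obtain ⟨k, hk⟩ := exists_eqLev hn
    have hkK : k ≤ K := hK p hp k hk
    obtain ⟨d, rfl⟩ : ∃ d, e1 = k + 1 + d := ⟨e1 - (k + 1), by omega⟩
    obtain ⟨l, hl, E', F', hE', hF', hne, hv, hs⟩ := exists_exposed_var hk.2 h1.1
    obtain ⟨y, hy, H, hH, hHy, hsH⟩ : ∃ y ∈ X, ∃ H, (H = E' ∨ H = F') ∧ H ≠ var G.sig y ∧
        Sim G (d + 1) (σ y) (subst σ H) := by
      rcases hv with ⟨x, rfl⟩ | ⟨x, rfl⟩
      · rw [subst_var] at hs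
        exact exists_var_in_support hσ hne.symm hs
      · rw [subst_var] at hs
        obtain ⟨y, hy, H, hH, h⟩ := exists_var_in_support hσ hne hs.symm
        exact ⟨y, hy, H, hH.symm, h⟩
    obtain ⟨M, hM, hlong⟩ := hL (y, H) ⟨by simpa using hy, p, hp, l, by omega, by
      rcases hH with rfl | rfl
      · exact Or.inl hE'
      · exact Or.inr hF'⟩ hHy
    obtain ⟨e', he', h3⟩ := (h2.anti (show L + K ≤ L + K + 1 by omega)).drop
    refine hlong (Function.update σ y (var G.sig y)) (fun n hn => ?_) e'
      (h3.map (m := d + 1) (by omega) (sim_eliminate hHy hsH hM))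
    by_cases hny : n = y
    · subst hny
      rw [Function.update_self]
    · rw [Function.update_of_ne hny]
      exact hσ n fun hX => hn (Finset.mem_erase.2 ⟨hny, hX⟩)

end Sequence

section Plays

open GTerm

/-- `E` depends only on the variables `x_n` with `n < m`. -/
def OnlyBelow {S : GrammarSig} (m : ℕ) (E : GTerm S) : Prop :=
  ∀ σ σ' : ℕ → GTerm S, (∀ n < m, σ n = σ' n) → subst σ E = subst σ' E

/-- Every branch of `X` meets a term from `Q`, or ends in a variable, at depth at most `h`. -/
inductive Barred {S : GrammarSig} (Q : GTerm S → Prop) : ℕ → GTerm S → Prop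
  | base {h : ℕ} {X : GTerm S} : Q X → Barred Q h X
  | var (h n : ℕ) : Barred Q h (var S n)
  | app {h : ℕ} (A : Fin S.ntCount) (c : Fin (S.arity A) → GTerm S) :
      (∀ i, Barred Q h (c i)) → Barred Q (h + 1) (app A c)

/-- The depth of the term is at most `d`. -/
def DepthLe {S : GrammarSig} (d : ℕ) (X : GTerm S) : Prop := Barred (fun _ => False) d X

section Depth

variable {S : GrammarSig}

theorem Barred.mono {Q : GTerm S → Prop} {h h' : ℕ} {X : GTerm S} (hX : Barred Q h X)
    (hle : h ≤ h') : Barred Q h' X := by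
  induction hX generalizing h' with
  | base hq => exact Barred.base hq
  | var => exact Barred.var _ _
  | app A c _ ih =>
    obtain ⟨k, rfl⟩ : ∃ k, h' = k + 1 := ⟨h' - 1, by omega⟩
    exact Barred.app A c fun i => ih i (by omega)

theorem DepthLe.mono {d d' : ℕ} {X : GTerm S} (hX : DepthLe d X) (hle : d ≤ d') :
    DepthLe d' X := Barred.mono hX hle

theorem DepthLe.app_inv {d : ℕ} {A : Fin S.ntCount} {c : Fin (S.arity A) → GTerm S}
    (h : DepthLe d (GTerm.app A c)) : ∃ d', d = d' + 1 ∧ ∀ i, DepthLe d' (c i) := by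
  generalize hX : GTerm.app A c = X at h
  cases h with
  | base hq => exact hq.elim
  | var => exact absurd hX app_ne_var
  | app B c' h =>
    obtain rfl := app_nt_inj hX
    obtain rfl := app_inj.1 hX
    exact ⟨_, rfl, h⟩

theorem DepthLe.child {d : ℕ} {A : Fin S.ntCount} {c : Fin (S.arity A) → GTerm S}
    (h : DepthLe d (GTerm.app A c)) (i : Fin (S.arity A)) : DepthLe d (c i) := by
  obtain ⟨d', rfl, h'⟩ := h.app_inv
  exact (h' i).mono (Nat.le_succ _)

theorem DepthLe.subterm {d : ℕ} {X Z : GTerm S} (h : DepthLe d X) (hZ : SubtermOf S Z X) :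
    DepthLe d Z := by
  induction hZ with
  | refl => exact h
  | tail _ hc ih =>
    obtain ⟨A, c, rfl, i, rfl⟩ := hc
    exact ih.child i

theorem DepthLe.barred_subst {Q : GTerm S → Prop} {a b : ℕ} {E : GTerm S} {σ : ℕ → GTerm S}
    (h : DepthLe a E) (hσ : ∀ n, Barred Q b (σ n)) : Barred Q (a + b) (GTerm.subst σ E) := by
  induction h with
  | base hq => exact hq.elim
  | var =>
    rw [subst_var]
    exact (hσ _).mono (Nat.le_add_left _ _)
  | app A c _ ih =>
    rw [subst_app, Nat.add_right_comm]
    exact Barred.app _ _ ih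

theorem DepthLe.subst {a b : ℕ} {E : GTerm S} {σ : ℕ → GTerm S} (h : DepthLe a E)
    (hσ : ∀ n, DepthLe b (σ n)) : DepthLe (a + b) (GTerm.subst σ E) := DepthLe.barred_subst h hσ

theorem depthLe_ext {d m : ℕ} {c : Fin m → GTerm S} (h : ∀ i, DepthLe d (c i)) (n : ℕ) :
    DepthLe d (ext c n) := by
  by_cases hn : n < m
  · rw [ext_of_lt c hn]
    exact h _
  · rw [show ext c n = var S n from dif_neg hn]
    exact Barred.var _ _

theorem depthLe_lhsTerm (A : Fin S.ntCount) : DepthLe 1 (lhsTerm A) :=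
  Barred.app _ _ fun _ => Barred.var _ _

theorem exists_depthLe_toTerm (E : FTerm S) : ∃ d, DepthLe d E.toTerm := by
  induction E with
  | var n => exact ⟨0, Barred.var _ _⟩
  | app A c ih =>
    obtain ⟨d, hd⟩ := exists_uniform (Set.finite_univ (α := Fin (S.arity A)))
      (Q := fun i d => DepthLe d (c i).toTerm) (fun _ _ _ hmn h => h.mono hmn) (fun i _ => ih i)
    exact ⟨d + 1, Barred.app _ _ fun i => hd i trivial⟩

theorem onlyBelow_lhsTerm (A : Fin S.ntCount) : OnlyBelow (S.arity A) (lhsTerm A) := by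
  intro σ σ' h
  rw [subst_lhsTerm, subst_lhsTerm, app_inj]
  funext i
  exact h _ i.2

theorem OnlyBelow.child {m : ℕ} {A : Fin S.ntCount} {c : Fin (S.arity A) → GTerm S}
    (h : OnlyBelow m (app A c)) (i : Fin (S.arity A)) : OnlyBelow m (c i) := by
  intro σ σ' hσ
  have := h σ σ' hσ
  rw [subst_app, subst_app, app_inj] at this
  exact congrFun this i

theorem OnlyBelow.var_lt {m n : ℕ} (h : OnlyBelow m (var S n)) : n < m := by
  by_contra hn
  have := h (var S) (fun k => if k < m then var S k else var S (n + 1)) fun k hk => (if_pos hk).symm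
  rw [subst_var, subst_var, if_neg hn, var_inj] at this
  omega

end Depth

variable {G : FOGrammar}

theorem OnlyBelow.step {m : ℕ} {E E' : GTerm G.sig} (h : OnlyBelow m E) (hs : Step G E E') :
    OnlyBelow m E' := by
  obtain ⟨a, r, -, -, c, rfl, rfl⟩ := hs
  intro σ σ' hσ
  rw [subst_subst, subst_subst]
  refine subst_toTerm_congr _ fun n hn => ?_
  rw [ext_of_lt _ (r.rhs_wf n hn)]
  exact h.child _ σ σ' hσ

theorem OnlyBelow.reach {m l : ℕ} {E E' : GTerm G.sig} (h : OnlyBelow m E) (hs : Reach G E l E') :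
    OnlyBelow m E' := by
  induction hs with
  | refl => exact h
  | tail _ hs ih => exact ih.step hs

/-- `M` bounds the lengths of shortest sequences exposing an argument, `ρ` bounds the growth of
the depth in a step. -/
structure Bounds (G : FOGrammar) (M ρ : ℕ) : Prop where
  pos : 1 ≤ M
  expose : ∀ (A : Fin G.sig.ntCount) (n l : ℕ), Reach G (lhsTerm A) l (var G.sig n) →
    ∃ l < M, Reach G (lhsTerm A) l (var G.sig n)
  step : ∀ (T T' : GTerm G.sig) (d : ℕ), Step G T T' → DepthLe d T → DepthLe (d + ρ) T'

theorem exists_bounds (G : FOGrammar) : ∃ M ρ, Bounds G M ρ := by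
  obtain ⟨M, hM⟩ := exists_uniform
    (Set.finite_univ (α := (A : Fin G.sig.ntCount) × Fin (G.sig.arity A)))
    (Q := fun p M => ∀ l, Reach G (lhsTerm p.1) l (var G.sig p.2) →
      ∃ l < M, Reach G (lhsTerm p.1) l (var G.sig p.2))
    (fun p m n hmn h l hl => by
      obtain ⟨l', hl', h'⟩ := h l hl
      exact ⟨l', by omega, h'⟩)
    (fun p _ => by
      by_cases h : ∃ l, Reach G (lhsTerm p.1) l (var G.sig p.2)
      · obtain ⟨l, hl⟩ := h
        exact ⟨l + 1, fun _ _ => ⟨l, by omega, hl⟩⟩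
      · exact ⟨0, fun l hl => absurd ⟨l, hl⟩ h⟩)
  obtain ⟨ρ, hρ⟩ := exists_uniform (List.finite_toSet G.rules)
    (Q := fun r d => DepthLe d r.rhs.toTerm) (fun _ _ _ hmn h => h.mono hmn)
    (fun r _ => exists_depthLe_toTerm _)
  refine ⟨M + 1, ρ, by omega, fun A n l hl => ?_, ?_⟩
  · have hn : n < G.sig.arity A := ((onlyBelow_lhsTerm A).reach hl).var_lt
    obtain ⟨l', hl', h'⟩ := hM ⟨A, n, hn⟩ trivial l hl
    exact ⟨l', by omega, h'⟩
  · rintro T T' d ⟨a, r, hr, -, c, rfl, rfl⟩ hd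
    rw [Nat.add_comm]
    exact DepthLe.subst (hρ r hr) (depthLe_ext hd.child)

variable {M ρ : ℕ}

theorem Bounds.reach (hB : Bounds G M ρ) {T T' : GTerm G.sig} {d l : ℕ} (h : Reach G T l T')
    (hd : DepthLe d T) : DepthLe (d + l * ρ) T' := by
  induction h with
  | refl => exact hd.mono (Nat.le_add_right _ _)
  | tail _ hs ih => exact (hB.step _ _ _ hs ih).mono (by rw [Nat.succ_mul, Nat.add_assoc])

theorem Bounds.reach_lhsTerm (hB : Bounds G M ρ) {A : Fin G.sig.ntCount} {F : GTerm G.sig}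
    (h : Reach G (lhsTerm A) M F) : DepthLe (1 + M * ρ) F := hB.reach h (depthLe_lhsTerm A)

/-- `x 0, …, x n` is a path. -/
def IsPath (G : FOGrammar) (n : ℕ) (x : ℕ → GTerm G.sig) : Prop :=
  ∀ t < n, Step G (x t) (x (t + 1))

theorem IsPath.shift {n : ℕ} {x : ℕ → GTerm G.sig} (h : IsPath G n x) (s : ℕ) :
    IsPath G (n - s) fun t => x (s + t) := fun t ht => h (s + t) (by omega)

theorem IsPath.reach {n : ℕ} {x : ℕ → GTerm G.sig} (h : IsPath G n x) {s l : ℕ}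
    (hl : s + l ≤ n) : Reach G (x s) l (x (s + l)) := by
  induction l with
  | zero => exact Reach.refl
  | succ l ih => exact (ih (by omega)).tail (h (s + l) (by omega))

theorem IsPath.lift {n : ℕ} {x : ℕ → GTerm G.sig} (h : IsPath G n x) {E : GTerm G.sig}
    {σ : ℕ → GTerm G.sig} (hx : x 0 = subst σ E) {l : ℕ} (hl : l ≤ n) :
    (∃ E', Reach G E l E' ∧ x l = subst σ E') ∨
      ∃ l' < l, ∃ k, Reach G E l' (var G.sig k) ∧ x l' = σ k := by
  induction l with
  | zero => exact Or.inl ⟨E, Reach.refl, hx⟩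
  | succ l ih =>
    rcases ih (by omega) with ⟨E', hE', hxl⟩ | ⟨l', hl', hk⟩
    · by_cases hv : IsVar E'
      · obtain ⟨k, rfl⟩ := hv
        exact Or.inr ⟨l, by omega, k, hE', by rw [hxl, subst_var]⟩
      · have hs := h l (by omega)
        rw [hxl] at hs
        obtain ⟨E'', hs', hE''⟩ := hs.subst_inv hv
        exact Or.inl ⟨E'', hE'.tail hs', hE''⟩
    · exact Or.inr ⟨l', by omega, hk⟩

/-- The `M` steps from `x t` do not expose an argument of `x t`. -/
def NonSinking (G : FOGrammar) (M : ℕ) (x : ℕ → GTerm G.sig) (t : ℕ) : Prop :=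
  ∃ (A : Fin G.sig.ntCount) (c : Fin (G.sig.arity A) → GTerm G.sig) (F : GTerm G.sig),
    x t = app A c ∧ Reach G (lhsTerm A) M F ∧ x (t + M) = subst (ext c) F

theorem IsPath.nonSinking_or {n : ℕ} {x : ℕ → GTerm G.sig} (h : IsPath G n x)
    {A : Fin G.sig.ntCount} {c : Fin (G.sig.arity A) → GTerm G.sig} (hx : x 0 = app A c)
    (hM : M ≤ n) : NonSinking G M x 0 ∨ ∃ l < M, l ≠ 0 ∧ ∃ i, x l = c i := by
  rcases h.lift (hx.trans (subst_ext_lhsTerm A c).symm) hM with ⟨F, hF, hxF⟩ | ⟨l, hl, k, hk, hxk⟩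
  · exact Or.inl ⟨A, c, F, hx, hF, by rwa [Nat.zero_add]⟩
  · refine Or.inr ⟨l, hl, ?_, ⟨k, ((onlyBelow_lhsTerm A).reach hk).var_lt⟩, ?_⟩
    · rintro rfl
      exact var_ne_app hk.zero_inv
    · rw [hxk, ext_of_lt]

theorem IsPath.sink (hM : 1 ≤ M) {Q : GTerm G.sig → Prop} {h n : ℕ} {x : ℕ → GTerm G.sig}
    {X : GTerm G.sig} (hX : Barred Q h X) (hx : IsPath G n x) (hx0 : x 0 = X) :
    ∃ t ≤ M * h, t ≤ n ∧
      (∀ s ≤ t, ∃ Z, SubtermOf G.sig Z (x 0) ∧ ∃ l ≤ M, Reach G Z l (x s)) ∧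
      (n < t + M ∨ (t + M ≤ n ∧ NonSinking G M x t) ∨ Q (x t)) := by
  have base : ∀ s ≤ 0, ∃ Z, SubtermOf G.sig Z (x 0) ∧ ∃ l ≤ M, Reach G Z l (x s) := by
    intro s hs
    obtain rfl : s = 0 := by omega
    exact ⟨x 0, Relation.ReflTransGen.refl, 0, Nat.zero_le _, Reach.refl⟩
  induction hX generalizing x n with
  | base hq =>
    rw [← hx0] at hq
    exact ⟨0, Nat.zero_le _, Nat.zero_le _, base, Or.inr (Or.inr hq)⟩
  | var _ k =>
    refine ⟨0, Nat.zero_le _, Nat.zero_le _, base, Or.inl ?_⟩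
    by_contra hn
    exact (hx 0 (by omega)).not_isVar ⟨k, hx0⟩
  | @app h A c _ ih =>
    by_cases hn : n < M
    · exact ⟨0, Nat.zero_le _, Nat.zero_le _, base, Or.inl (by omega)⟩
    rcases hx.nonSinking_or hx0 (show M ≤ n by omega) with hs | ⟨l, hl, hl0, i, hi⟩
    · exact ⟨0, Nat.zero_le _, Nat.zero_le _, base, Or.inr (Or.inl ⟨by omega, hs⟩)⟩
    · obtain ⟨t, ht, htn, hsub, hend⟩ := ih i (hx.shift l) (x := fun t => x (l + t)) hi (by
        intro s hs
        obtain rfl : s = 0 := by omega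
        exact ⟨_, Relation.ReflTransGen.refl, 0, Nat.zero_le _, Reach.refl⟩)
      refine ⟨l + t, ?_, by omega, fun s hs => ?_, ?_⟩
      · rw [Nat.mul_succ]
        omega
      · by_cases hsl : s ≤ l
        · refine ⟨x 0, Relation.ReflTransGen.refl, s, by omega, ?_⟩
          have := hx.reach (s := 0) (l := s) (by omega)
          rwa [Nat.zero_add] at this
        · obtain ⟨Z, hZ, l', hl', hr⟩ := hsub (s - l) (by omega)
          refine ⟨Z, Relation.ReflTransGen.head ?_ hZ, l', hl', ?_⟩
          · exact ⟨A, c, hx0, i, hi⟩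
          · have hsl' : l + (s - l) = s := by omega
            simpa only [hsl'] using hr
      · rcases hend with h | ⟨h, h'⟩ | h
        · exact Or.inl (by omega)
        · refine Or.inr (Or.inl ⟨by omega, ?_⟩)
          obtain ⟨B, d, F, h1, h2, h3⟩ := h'
          exact ⟨B, d, F, h1, h2, by rwa [Nat.add_assoc]⟩
        · exact Or.inr (Or.inr h)

/-- An optimal play of length `e` from a pair with equivalence level `e`. -/
structure IsPlay (G : FOGrammar) (e : ℕ) (x y : ℕ → GTerm G.sig) : Prop where
  left : IsPath G e x
  right : IsPath G e y
  eqLev : ∀ t ≤ e, EqLev G (e - t) (x t) (y t)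

theorem IsPlay.symm {e : ℕ} {x y : ℕ → GTerm G.sig} (h : IsPlay G e x y) : IsPlay G e y x :=
  ⟨h.right, h.left, fun t ht => (h.eqLev t ht).symm⟩

theorem EqLev.exists_play {e : ℕ} {X Y : GTerm G.sig} (h : EqLev G e X Y) :
    ∃ x y, x 0 = X ∧ y 0 = Y ∧ IsPlay G e x y := by
  induction e generalizing X Y with
  | zero =>
    refine ⟨fun _ => X, fun _ => Y, rfl, rfl, fun t ht => by omega, fun t ht => by omega, ?_⟩
    intro t ht
    obtain rfl : t = 0 := by omega
    exact h
  | succ e ih =>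
    obtain ⟨X', Y', hX, hY, h'⟩ := h.step
    obtain ⟨x, y, rfl, rfl, hp⟩ := ih h'
    refine ⟨fun t => t.casesOn X x, fun t => t.casesOn Y y, rfl, rfl, ?_, ?_, ?_⟩
    · intro t ht
      cases t with
      | zero => exact hX
      | succ t => exact hp.left t (by omega)
    · intro t ht
      cases t with
      | zero => exact hY
      | succ t => exact hp.right t (by omega)
    · intro t ht
      cases t with
      | zero => exact h
      | succ t =>
        rw [Nat.add_sub_add_right]
        exact hp.eqLev t (by omega)

/-- The pair `(X, Y)` is the result of a balancing step with pivot `W`. -/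
def Stage (G : FOGrammar) (M : ℕ) (W X Y : GTerm G.sig) : Prop :=
  ∃ (A : Fin G.sig.ntCount) (F : GTerm G.sig) (σ : ℕ → GTerm G.sig), Reach G (lhsTerm A) M F ∧
    (∀ n, ∃ l ≤ M, Reach G W l (σ n)) ∧ X = subst σ F ∧ Reach G W M Y

theorem IsPlay.balance (hB : Bounds G M ρ) {e t : ℕ} {x y : ℕ → GTerm G.sig}
    (h : IsPlay G e x y) (ht : t + M ≤ e) (hs : NonSinking G M x t) :
    ∃ X, Stage G M (y t) X (y (t + M)) ∧ EqLev G (e - (t + M)) X (y (t + M)) := by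
  obtain ⟨A, c, F, hx, hF, hxF⟩ := hs
  have hsim := (h.eqLev t (by omega)).1
  have hσ : ∀ n, ∃ V, (∃ l ≤ M, Reach G (y t) l V) ∧
      ((∃ l, Reach G (lhsTerm A) l (var G.sig n)) → Sim G (e - (t + M) + 1) (ext c n) V) := by
    intro n
    by_cases hn : ∃ l, Reach G (lhsTerm A) l (var G.sig n)
    · obtain ⟨l, hl⟩ := hn
      obtain ⟨l, hlM, hl⟩ := hB.expose A n l hl
      have hr := hl.subst (ext c)
      rw [subst_ext_lhsTerm, subst_var, ← hx] at hr
      obtain ⟨V, hV, hsV⟩ := hsim.reach hr (by omega)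
      exact ⟨V, ⟨l, hlM.le, hV⟩, fun _ => hsV.mono (by omega)⟩
    · exact ⟨y t, ⟨0, Nat.zero_le _, Reach.refl⟩, fun h => absurd h hn⟩
  choose σ hσ1 hσ2 using hσ
  refine ⟨subst σ F, ⟨A, F, σ, hF, hσ1, rfl, h.right.reach ht⟩, ?_⟩
  have hlev := h.eqLev (t + M) ht
  rw [hxF] at hlev
  refine hlev.congr (sim_subst_of_reach fun l hl n hn => ?_) (Sim.refl _ _)
  exact (hσ2 n ⟨_, hF.trans hn⟩).mono (by omega)

/-- `Stage` up to exchanging the two components. -/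
def StageSymm (G : FOGrammar) (M : ℕ) (W X Y : GTerm G.sig) : Prop :=
  Stage G M W X Y ∨ Stage G M W Y X

/-- The pair with equivalence level `e` is followed, after at most `b` steps, by a balanced pair
with equivalence level smaller than `e` whose pivot has the property `Q`. -/
def Next (G : FOGrammar) (M b e : ℕ) (Q : GTerm G.sig → Prop) : Prop :=
  ∃ W X Y e', StageSymm G M W X Y ∧ EqLev G e' X Y ∧ e' < e ∧ e ≤ e' + b ∧ Q W

theorem Next.imp {b b' e e' : ℕ} {Q Q' : GTerm G.sig → Prop} (h : Next G M b e Q)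
    (he : e ≤ e') (hb : e' + b ≤ e + b') (hQ : ∀ W, Q W → Q' W) : Next G M b' e' Q' := by
  obtain ⟨W, X, Y, f, h1, h2, h3, h4, h5⟩ := h
  exact ⟨W, X, Y, f, h1, h2, by omega, by omega, hQ W h5⟩

theorem IsPlay.next (hB : Bounds G M ρ) {e t b : ℕ} {x y : ℕ → GTerm G.sig}
    (h : IsPlay G e x y) (ht : t + M ≤ e) (hb : t + M ≤ b) (hs : NonSinking G M x t) :
    Next G M b e (fun W => W = y t) := by
  obtain ⟨X, hX, hlev⟩ := h.balance hB ht hs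
  have := hB.pos
  exact ⟨y t, X, _, _, Or.inl hX, hlev, by omega, by omega, rfl⟩

theorem IsPlay.next_symm (hB : Bounds G M ρ) {e t b : ℕ} {x y : ℕ → GTerm G.sig}
    (h : IsPlay G e x y) (ht : t + M ≤ e) (hb : t + M ≤ b) (hs : NonSinking G M y t) :
    Next G M b e (fun W => W = x t) := by
  obtain ⟨X, hX, hlev⟩ := h.symm.balance hB ht hs
  have := hB.pos
  exact ⟨x t, _, X, _, Or.inr hX, hlev.symm, by omega, by omega, rfl⟩

theorem EqLev.next_of_depthLe (hB : Bounds G M ρ) {e d : ℕ} {X Y : GTerm G.sig}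
    (h : EqLev G e X Y) (hX : DepthLe d X) (hY : DepthLe d Y) :
    e ≤ M * (d + 1) ∨ Next G M (M * (d + 1)) e (fun W => ∃ Z, (SubtermOf G.sig Z X ∨
      SubtermOf G.sig Z Y) ∧ ∃ l ≤ M, Reach G Z l W) := by
  by_cases he : e ≤ M * (d + 1)
  · exact Or.inl he
  right
  rw [Nat.mul_succ] at he ⊢
  obtain ⟨x, y, rfl, rfl, hp⟩ := h.exists_play
  obtain ⟨t, ht, -, hsub, hend⟩ := hp.left.sink hB.pos hX rfl
  obtain ⟨t', ht', -, hsub', hend'⟩ := hp.right.sink hB.pos hY rfl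
  have hs : NonSinking G M x t := by
    rcases hend with h | ⟨-, h⟩ | h
    · omega
    · exact h
    · exact h.elim
  have hs' : NonSinking G M y t' := by
    rcases hend' with h | ⟨-, h⟩ | h
    · omega
    · exact h
    · exact h.elim
  rcases le_total t t' with htt | htt
  · refine (hp.next hB (by omega) (b := M * d + M) (by omega) hs).imp le_rfl le_rfl ?_
    rintro _ rfl
    obtain ⟨Z, hZ, hr⟩ := hsub' t htt
    exact ⟨Z, Or.inr hZ, hr⟩
  · refine (hp.next_symm hB (by omega) (b := M * d + M) (by omega) hs').imp le_rfl le_rfl ?_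
    rintro _ rfl
    obtain ⟨Z, hZ, hr⟩ := hsub t' htt
    exact ⟨Z, Or.inl hZ, hr⟩

/-- The number of steps after which arguments are exposed from a balancing result. -/
def linkLength (M ρ : ℕ) : ℕ := M + M * (1 + M * ρ)

/-- `W'` is obtained from `W` by some steps, taking a subterm and some more steps. -/
def Link (G : FOGrammar) (M ρ : ℕ) (W W' : GTerm G.sig) : Prop :=
  ∃ Z, (∃ l ≤ linkLength M ρ, Reach G W l Z) ∧
    ∃ Z', SubtermOf G.sig Z' Z ∧ ∃ l ≤ M, Reach G Z' l W'

/-- A bound for the distance of consecutive balancing steps. -/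
def gap (M ρ d : ℕ) : ℕ := M * (1 + M * ρ) + M * (d + linkLength M ρ * ρ + 1)

theorem Stage.next (hB : Bounds G M ρ) {e d : ℕ} {W X Y : GTerm G.sig} (hst : Stage G M W X Y)
    (h : EqLev G e X Y) (hW : DepthLe d W) :
    e ≤ gap M ρ d ∨ Next G M (gap M ρ d) e (Link G M ρ W) := by
  obtain ⟨A, F, σ, hF, hσ, rfl, hY⟩ := hst
  have hg : gap M ρ d = M * (1 + M * ρ) + (M * (d + linkLength M ρ * ρ) + M) := by
    rw [gap, Nat.mul_succ]
  have hl : linkLength M ρ = M + M * (1 + M * ρ) := rfl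
  obtain ⟨x, y, hx, rfl, hp⟩ := h.exists_play
  have hbar : Barred (fun V => ∃ l ≤ M, Reach G W l V) (1 + M * ρ) (subst σ F) :=
    DepthLe.barred_subst (b := 0) (hB.reach_lhsTerm hF) fun n => Barred.base (hσ n)
  obtain ⟨t, ht, hte, -, hend⟩ := hp.left.sink hB.pos hbar hx
  have hyt : Reach G W (M + t) (y t) := by
    have := hY.trans (hp.right.reach (s := 0) (l := t) (by omega))
    rwa [Nat.zero_add] at this
  rcases hend with hlt | ⟨hle, hs⟩ | ⟨l, hlM, hr⟩
  · left
    omega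
  · right
    refine (hp.next hB hle (b := gap M ρ d) (by omega) hs).imp le_rfl le_rfl ?_
    rintro _ rfl
    exact ⟨y t, ⟨_, by omega, hyt⟩, y t, Relation.ReflTransGen.refl, 0, Nat.zero_le _, Reach.refl⟩
  · have hdx : DepthLe (d + linkLength M ρ * ρ) (x t) :=
      (hB.reach hr hW).mono (Nat.add_le_add_left (Nat.mul_le_mul_right _ (by omega)) _)
    have hdy : DepthLe (d + linkLength M ρ * ρ) (y t) :=
      (hB.reach hyt hW).mono (Nat.add_le_add_left (Nat.mul_le_mul_right _ (by omega)) _)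
    rcases (hp.eqLev t hte).next_of_depthLe hB hdx hdy with hle | hn
    · left
      rw [Nat.mul_succ] at hle
      omega
    · right
      refine hn.imp (by omega) (by rw [Nat.mul_succ]; omega) ?_
      rintro W' ⟨Z, hZ | hZ, hr'⟩
      · exact ⟨x t, ⟨l, by omega, hr⟩, Z, hZ, hr'⟩
      · exact ⟨y t, ⟨_, by omega, hyt⟩, Z, hZ, hr'⟩

theorem StageSymm.next (hB : Bounds G M ρ) {e d : ℕ} {W X Y : GTerm G.sig}
    (hst : StageSymm G M W X Y) (h : EqLev G e X Y) (hW : DepthLe d W) :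
    e ≤ gap M ρ d ∨ Next G M (gap M ρ d) e (Link G M ρ W) := by
  rcases hst with hst | hst
  · exact hst.next hB h hW
  · exact hst.next hB h.symm hW

end Plays

section Patterns

open GTerm

variable {G : FOGrammar} {M ρ : ℕ}

/-- The terms obtained from `A(x_0, …)` by taking subterms and at most `k` steps. -/
inductive Pattern (G : FOGrammar) (A : Fin G.sig.ntCount) : ℕ → GTerm G.sig → Prop
  | base (k : ℕ) : Pattern G A k (lhsTerm A)
  | step {k : ℕ} {E E' : GTerm G.sig} : Pattern G A k E → Step G E E' → Pattern G A (k + 1) E'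
  | child {k : ℕ} {B : Fin G.sig.ntCount} {d : Fin (G.sig.arity B) → GTerm G.sig}
      (i : Fin (G.sig.arity B)) : Pattern G A k (app B d) → Pattern G A k (d i)

theorem Pattern.mono {A : Fin G.sig.ntCount} {k k' : ℕ} {E : GTerm G.sig} (h : Pattern G A k E)
    (hle : k ≤ k') : Pattern G A k' E := by
  induction h generalizing k' with
  | base => exact Pattern.base _
  | step _ hs ih =>
    obtain ⟨j, rfl⟩ : ∃ j, k' = j + 1 := ⟨k' - 1, by omega⟩
    exact (ih (by omega)).step hs
  | child i _ ih => exact (ih hle).child i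

theorem Pattern.reach {A : Fin G.sig.ntCount} {k l : ℕ} {E E' : GTerm G.sig}
    (h : Pattern G A k E) (hr : Reach G E l E') : Pattern G A (k + l) E' := by
  induction hr with
  | refl => exact h
  | tail _ hs ih => exact ih.step hs

theorem Pattern.onlyBelow {A : Fin G.sig.ntCount} {k : ℕ} {E : GTerm G.sig}
    (h : Pattern G A k E) : OnlyBelow (G.sig.arity A) E := by
  induction h with
  | base => exact onlyBelow_lhsTerm A
  | step _ hs ih => exact ih.step hs
  | child i _ ih => exact ih.child i

theorem Pattern.depthLe (hB : Bounds G M ρ) {A : Fin G.sig.ntCount} {k : ℕ} {E : GTerm G.sig}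
    (h : Pattern G A k E) : DepthLe (1 + k * ρ) E := by
  induction h with
  | base => exact (depthLe_lhsTerm A).mono (Nat.le_add_right _ _)
  | step _ hs ih => exact (hB.step _ _ _ hs ih).mono (by rw [Nat.succ_mul, Nat.add_assoc])
  | child i _ ih => exact ih.child i

theorem DepthLe.finite_subterms {S : GrammarSig} {d : ℕ} {X : GTerm S} (h : DepthLe d X) :
    {Z | SubtermOf S Z X}.Finite := by
  induction h with
  | base hq => exact hq.elim
  | var _ n =>
    refine (Set.finite_singleton (GTerm.var S n)).subset fun Z hZ => ?_
    rcases Relation.ReflTransGen.cases_head hZ with h | ⟨_, ⟨A, c, h, -⟩, -⟩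
    · exact h.symm
    · exact absurd h var_ne_app
  | app A c _ ih =>
    refine ((Set.finite_singleton (GTerm.app A c)).union (Set.finite_iUnion ih)).subset
      fun Z hZ => ?_
    rcases Relation.ReflTransGen.cases_head hZ with h | ⟨_, ⟨B, c', h, i, rfl⟩, h'⟩
    · exact Or.inl h.symm
    · obtain rfl := app_nt_inj h
      obtain rfl := app_inj.1 h
      exact Or.inr (Set.mem_iUnion.2 ⟨i, h'⟩)

theorem Pattern.cases_subterm {A : Fin G.sig.ntCount} {k : ℕ} {E : GTerm G.sig}
    (h : Pattern G A k E) : SubtermOf G.sig E (lhsTerm A) ∨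
      ∃ j, k = j + 1 ∧ ∃ E₀, Pattern G A j E₀ ∧ ∃ E₁, Step G E₀ E₁ ∧ SubtermOf G.sig E E₁ := by
  induction h with
  | base => exact Or.inl Relation.ReflTransGen.refl
  | step h hs _ => exact Or.inr ⟨_, rfl, _, h, _, hs, Relation.ReflTransGen.refl⟩
  | @child k B d i _ ih =>
    have hc : childRel G.sig (app B d) (d i) := ⟨B, d, rfl, i, rfl⟩
    rcases ih with h | ⟨j, hj, E₀, h₀, E₁, h₁, h⟩
    · exact Or.inl (h.tail hc)
    · exact Or.inr ⟨j, hj, E₀, h₀, E₁, h₁, h.tail hc⟩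

theorem Pattern.finite (hB : Bounds G M ρ) (A : Fin G.sig.ntCount) (k : ℕ) :
    {E | Pattern G A k E}.Finite := by
  induction k with
  | zero =>
    refine (depthLe_lhsTerm A).finite_subterms.subset fun E hE => ?_
    rcases Pattern.cases_subterm hE with h | ⟨j, hj, -⟩
    · exact h
    · omega
  | succ k ih =>
    have h1 : (⋃ E₀ ∈ {E | Pattern G A k E}, {E₁ | Step G E₀ E₁}).Finite :=
      ih.biUnion fun E₀ _ => Step.finite E₀
    have h2 : (⋃ E₁ ∈ ⋃ E₀ ∈ {E | Pattern G A k E}, {E₁ | Step G E₀ E₁},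
        {Z | SubtermOf G.sig Z E₁}).Finite := by
      refine h1.biUnion fun E₁ hE₁ => ?_
      simp only [Set.mem_iUnion] at hE₁
      obtain ⟨E₀, h₀, hs⟩ := hE₁
      exact (Pattern.depthLe hB (Pattern.step h₀ hs)).finite_subterms
    refine ((depthLe_lhsTerm A).finite_subterms.union h2).subset fun E hE => ?_
    rcases Pattern.cases_subterm hE with h | ⟨j, hj, E₀, h₀, E₁, h₁, h⟩
    · exact Or.inl h
    · obtain rfl : j = k := by omega
      refine Or.inr ?_
      simp only [Set.mem_iUnion]
      exact ⟨E₁, ⟨E₀, h₀, h₁⟩, h⟩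

/-- `W` is a proper instance of a pattern of `A` under `x_i ↦ c i`. -/
def InstanceAt (G : FOGrammar) (A : Fin G.sig.ntCount) (c : Fin (G.sig.arity A) → GTerm G.sig)
    (k : ℕ) (W : GTerm G.sig) : Prop :=
  ∃ E, Pattern G A k E ∧ ¬ IsVar E ∧ W = subst (ext c) E

theorem InstanceAt.mono {A : Fin G.sig.ntCount} {c : Fin (G.sig.arity A) → GTerm G.sig}
    {k k' : ℕ} {W : GTerm G.sig} (h : InstanceAt G A c k W) (hle : k ≤ k') :
    InstanceAt G A c k' W := by
  obtain ⟨E, h1, h2⟩ := h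
  exact ⟨E, h1.mono hle, h2⟩

theorem InstanceAt.depthLe (hB : Bounds G M ρ) {A : Fin G.sig.ntCount}
    {c : Fin (G.sig.arity A) → GTerm G.sig} {k d : ℕ} {W : GTerm G.sig}
    (h : InstanceAt G A c k W) (hc : DepthLe d (app A c)) : DepthLe (1 + k * ρ + d) W := by
  obtain ⟨E, h1, -, rfl⟩ := h
  exact (h1.depthLe hB).subst (depthLe_ext hc.child)

/-- `W` is a variable or an instance of a pattern at a term that is allowed by `D`. -/
def Tracked (G : FOGrammar) (D : ℕ → GTerm G.sig → Prop) (k : ℕ) (W : GTerm G.sig) : Prop :=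
  IsVar W ∨ ∃ B c j, D j (app B c) ∧ InstanceAt G B c (j + k) W

section Tracked

variable {D : ℕ → GTerm G.sig → Prop}

theorem tracked_subst (hD : ∀ j B c i, D j (app B c) → D 0 (c i)) {B : Fin G.sig.ntCount}
    {c : Fin (G.sig.arity B) → GTerm G.sig} {j k : ℕ} (h : D j (app B c)) {E : GTerm G.sig}
    (hE : Pattern G B (j + k) E) : Tracked G D k (subst (ext c) E) := by
  by_cases hv : IsVar E
  · obtain ⟨n, rfl⟩ := hv
    have hn := hE.onlyBelow.var_lt
    rw [subst_var, ext_of_lt c hn]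
    have h0 := hD j B c ⟨n, hn⟩ h
    rcases var_or_app (c ⟨n, hn⟩) with ⟨m, hm⟩ | ⟨A, d, hd⟩
    · exact Or.inl ⟨m, hm⟩
    · rw [hd] at h0 ⊢
      exact Or.inr ⟨A, d, 0, h0, lhsTerm A, Pattern.base _, not_isVar_app,
        (subst_ext_lhsTerm A d).symm⟩
  · exact Or.inr ⟨B, c, j, h, E, hE, hv, rfl⟩

theorem Tracked.step (hD : ∀ j B c i, D j (app B c) → D 0 (c i)) {k : ℕ} {W W' : GTerm G.sig}
    (h : Tracked G D k W) (hs : Step G W W') : Tracked G D (k + 1) W' := by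
  rcases h with h | ⟨B, c, j, hj, E, hE, hv, rfl⟩
  · exact absurd h hs.not_isVar
  · obtain ⟨E', hE', rfl⟩ := hs.subst_inv hv
    exact tracked_subst hD hj (hE.step hE')

theorem Tracked.reach (hD : ∀ j B c i, D j (app B c) → D 0 (c i)) {k l : ℕ} {W W' : GTerm G.sig}
    (h : Tracked G D k W) (hr : Reach G W l W') : Tracked G D (k + l) W' := by
  induction hr with
  | refl => exact h
  | tail _ hs ih => exact ih.step hD hs

theorem Tracked.subterm (hD : ∀ j B c i, D j (app B c) → D 0 (c i)) {k : ℕ} {W Z : GTerm G.sig}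
    (h : Tracked G D k W) (hZ : SubtermOf G.sig Z W) : Tracked G D k Z := by
  induction hZ with
  | refl => exact h
  | tail _ hc ih =>
    obtain ⟨A, d, rfl, i, rfl⟩ := hc
    rcases ih with h | ⟨B, c, j, hj, E, hE, hv, hW⟩
    · exact absurd h not_isVar_app
    · obtain ⟨A', d', rfl⟩ := exists_app_of_not_isVar hv
      rw [subst_app] at hW
      obtain rfl := app_nt_inj hW
      obtain rfl := app_inj.1 hW
      exact tracked_subst hD hj (hE.child i)

theorem Tracked.mono {k k' : ℕ} {W : GTerm G.sig} (h : Tracked G D k W) (hle : k ≤ k') :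
    Tracked G D k' W := by
  rcases h with h | ⟨B, c, j, hj, h⟩
  · exact Or.inl h
  · exact Or.inr ⟨B, c, j, hj, h.mono (by omega)⟩

end Tracked

theorem StageSymm.pivot_not_isVar (hB : Bounds G M ρ) {W X Y : GTerm G.sig}
    (h : StageSymm G M W X Y) : ¬ IsVar W := by
  have hM := hB.pos
  rcases h with ⟨_, _, _, _, _, _, hr⟩ | ⟨_, _, _, _, _, _, hr⟩ <;>
  exact hr.not_isVar (by omega)

/-- A bound for the growth of patterns between consecutive balancing steps. -/
def linkIndex (M ρ : ℕ) : ℕ := linkLength M ρ + M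

theorem Link.instanceAt {A : Fin G.sig.ntCount} {c : Fin (G.sig.arity A) → GTerm G.sig}
    {k h : ℕ} {W W' : GTerm G.sig} (hL : Link G M ρ W W') (hW : InstanceAt G A c k W)
    (hc : DepthLe (h + 1) (app A c)) (hv : ¬ IsVar W') :
    InstanceAt G A c (k + linkIndex M ρ) W' ∨
      ∃ B d, DepthLe h (app B d) ∧ InstanceAt G B d (linkIndex M ρ) W' := by
  obtain ⟨d', hd', hc'⟩ := hc.app_inv
  obtain rfl : h = d' := by omega
  let D : ℕ → GTerm G.sig → Prop := fun j V => (j = k ∧ V = app A c) ∨ (j = 0 ∧ DepthLe h V)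
  have hD : ∀ j B c i, D j (app B c) → D 0 (c i) := by
    rintro j B d i (⟨-, h⟩ | ⟨-, h⟩)
    · obtain rfl := app_nt_inj h
      obtain rfl := app_inj.1 h
      exact Or.inr ⟨rfl, hc' i⟩
    · exact Or.inr ⟨rfl, h.child i⟩
  have h0 : Tracked G D 0 W := Or.inr ⟨A, c, k, Or.inl ⟨rfl, rfl⟩, hW⟩
  obtain ⟨Z, ⟨l, hl, hZ⟩, Z', hZ', l', hl', hr⟩ := hL
  have h1 : Tracked G D (linkIndex M ρ) W' :=
    (((h0.reach hD hZ).subterm hD hZ').reach hD hr).mono (by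
      have : linkIndex M ρ = linkLength M ρ + M := rfl
      omega)
  rcases h1 with h | ⟨B, d, j, ⟨rfl, hj⟩ | ⟨rfl, hj⟩, h⟩
  · exact absurd h hv
  · obtain rfl := app_nt_inj hj
    obtain rfl := app_inj.1 hj
    exact Or.inl h
  · rw [Nat.zero_add] at h
    exact Or.inr ⟨B, d, hj, h⟩

theorem DepthLe.instanceAt_of_reach {d l : ℕ} {Z W : GTerm G.sig} (hZ : DepthLe d Z)
    (hr : Reach G Z l W) (hv : ¬ IsVar W) :
    ∃ B c, DepthLe d (app B c) ∧ InstanceAt G B c l W := by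
  let D : ℕ → GTerm G.sig → Prop := fun j V => j = 0 ∧ DepthLe d V
  have hD : ∀ j B c i, D j (app B c) → D 0 (c i) := fun j B c i h => ⟨rfl, h.2.child i⟩
  have h0 : Tracked G D 0 Z := by
    rcases var_or_app Z with ⟨n, rfl⟩ | ⟨A, c, rfl⟩
    · exact Or.inl ⟨n, rfl⟩
    · exact Or.inr ⟨A, c, 0, ⟨rfl, hZ⟩, lhsTerm A, Pattern.base _, not_isVar_app,
        (subst_ext_lhsTerm A c).symm⟩
  rcases h0.reach hD hr with h | ⟨B, c, j, ⟨rfl, hj⟩, h⟩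
  · exact absurd h hv
  · rw [Nat.zero_add, Nat.zero_add] at h
    exact ⟨B, c, hj, h⟩

theorem exists_step_finset (G : FOGrammar) :
    ∃ N, ∀ T : GTerm G.sig, ∃ s : Finset (GTerm G.sig), s.card ≤ N ∧ ∀ V, Step G T V → V ∈ s := by
  classical
  refine ⟨G.rules.length, fun T => ⟨(G.rules.map fun r =>
    if h : ∃ c, T = app r.nt c then subst (ext h.choose) r.rhs.toTerm else T).toFinset, ?_, ?_⟩⟩
  · exact (List.toFinset_card_le _).trans (List.length_map _).le
  · rintro V ⟨a, r, hr, -, c, rfl, rfl⟩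
    rw [List.mem_toFinset, List.mem_map]
    have h : ∃ c', app r.nt c = app r.nt c' := ⟨c, rfl⟩
    refine ⟨r, hr, ?_⟩
    rw [dif_pos h, ← app_inj.1 h.choose_spec]

theorem exists_reach_finset (G : FOGrammar) (l : ℕ) :
    ∃ N, ∀ T : GTerm G.sig, ∃ s : Finset (GTerm G.sig), s.card ≤ N ∧
      ∀ k ≤ l, ∀ V, Reach G T k V → V ∈ s := by
  classical
  induction l with
  | zero =>
    refine ⟨1, fun T => ⟨{T}, by simp, fun k hk V hV => ?_⟩⟩
    obtain rfl : k = 0 := by omega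
    simp [hV.zero_inv]
  | succ l ih =>
    obtain ⟨N, hN⟩ := ih
    obtain ⟨N', hN'⟩ := exists_step_finset G
    choose s hs hs' using hN
    choose s' hc hc' using hN'
    refine ⟨N + N * N', fun T => ⟨s T ∪ (s T).biUnion s', ?_, fun k hk V hV => ?_⟩⟩
    · refine (Finset.card_union_le _ _).trans (Nat.add_le_add (hs T) ?_)
      exact (Finset.card_biUnion_le_card_mul _ _ _ fun V _ => hc V).trans
        (Nat.mul_le_mul_right _ (hs T))
    · rw [Finset.mem_union]
      cases hV with
      | refl => exact Or.inl (hs' T 0 (Nat.zero_le _) T Reach.refl)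
      | tail hr hst =>
        exact Or.inr (Finset.mem_biUnion.2 ⟨_, hs' T _ (by omega) _ hr, hc' _ _ hst⟩)

/-- There is a substitution listing the arguments `c i` and everything reached from them in
at most `M` steps, with support bounded independently of `c`. -/
theorem exists_listing (G : FOGrammar) (M m : ℕ) :
    ∃ N, ∀ c : Fin m → GTerm G.sig, ∃ τ : ℕ → GTerm G.sig, (∀ n < m, τ n = ext c n) ∧
      (∀ n, N ≤ n → τ n = var G.sig n) ∧
      ∀ i, ∀ l ≤ M, ∀ V, Reach G (c i) l V → ∃ n < N, τ n = V := by
  classical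
  obtain ⟨N, hN⟩ := exists_reach_finset G M
  choose s hs hs' using hN
  refine ⟨m + m * N, fun c => ?_⟩
  let u : Finset (GTerm G.sig) := Finset.univ.biUnion fun i => s (c i)
  have hu : u.card ≤ m * N := by
    refine (Finset.card_biUnion_le_card_mul _ _ N fun i _ => hs _).trans ?_
    rw [Finset.card_univ, Fintype.card_fin]
  refine ⟨fun n => (List.ofFn c ++ u.toList).getD n (var G.sig n), fun n hn => ?_,
    fun n hn => ?_, fun i l hl V hV => ?_⟩
  · have h1 : n < (List.ofFn c).length := by rwa [List.length_ofFn]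
    change List.getD _ _ _ = _
    rw [List.getD_append _ _ _ _ h1, List.getD_eq_getElem _ _ h1, List.getElem_ofFn,
      ext_of_lt c hn]
  · change List.getD _ _ _ = _
    refine List.getD_eq_default _ _ ?_
    rw [List.length_append, List.length_ofFn, Finset.length_toList]
    omega
  · have hVu : V ∈ u.toList := by
      rw [Finset.mem_toList]
      exact Finset.mem_biUnion.2 ⟨i, Finset.mem_univ _, hs' _ l hl V hV⟩
    obtain ⟨n, hn, rfl⟩ := List.mem_iff_getElem.1 (List.mem_append_right (List.ofFn c) hVu)
    refine ⟨n, ?_, List.getD_eq_getElem _ _ hn⟩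
    rw [List.length_append, List.length_ofFn, Finset.length_toList] at hn
    omega

theorem Reach.lift {E V : GTerm G.sig} {σ : ℕ → GTerm G.sig} {l : ℕ}
    (h : Reach G (GTerm.subst σ E) l V) : (∃ E', Reach G E l E' ∧ V = GTerm.subst σ E') ∨
      ∃ l' k n, l' + k ≤ l ∧ Reach G E l' (var G.sig n) ∧ Reach G (σ n) k V := by
  induction h with
  | refl => exact Or.inl ⟨E, Reach.refl, rfl⟩
  | @tail l T' T'' hr hs ih =>
    rcases ih with ⟨E', hE', rfl⟩ | ⟨l', k, n, hle, hE', hr'⟩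
    · by_cases hv : IsVar E'
      · obtain ⟨n, rfl⟩ := hv
        rw [subst_var] at hs
        exact Or.inr ⟨l, 1, n, le_rfl, hE', Reach.single hs⟩
      · obtain ⟨E'', hs', rfl⟩ := hs.subst_inv hv
        exact Or.inl ⟨E'', hE'.tail hs', rfl⟩
    · exact Or.inr ⟨l', k + 1, n, by omega, hE', hr'.tail hs⟩

/-- The terms needed to describe what is reached in at most `M` steps from instances of the
patterns of `A` with index `k`. -/
def nearPatterns (G : FOGrammar) (M N : ℕ) (A : Fin G.sig.ntCount) (k : ℕ) : Set (GTerm G.sig) :=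
  {E | Pattern G A (k + M) E} ∪ (var G.sig '' Set.Iio N)

/-- The patterns of balancing results. -/
def stagePatterns (G : FOGrammar) (M N : ℕ) (A : Fin G.sig.ntCount) (k : ℕ) : Set (GTerm G.sig) :=
  nearPatterns G M N A k ∪ ⋃ B : Fin G.sig.ntCount,
    Set.image2 (fun (f : Fin (G.sig.arity B) → GTerm G.sig) F => subst (ext f) F)
      {f | ∀ i, f i ∈ nearPatterns G M N A k} {F | Reach G (lhsTerm B) M F}

theorem stagePatterns_finite (hB : Bounds G M ρ) (N : ℕ) (A : Fin G.sig.ntCount) (k : ℕ) :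
    (stagePatterns G M N A k).Finite := by
  have h : (nearPatterns G M N A k).Finite :=
    (Pattern.finite hB A (k + M)).union ((Set.finite_Iio N).image _)
  exact h.union (Set.finite_iUnion fun B => Set.Finite.image2 _ (Set.Finite.pi' fun _ => h)
    (Reach.finite _ _))

theorem InstanceAt.exists_nearPattern {A : Fin G.sig.ntCount}
    {c : Fin (G.sig.arity A) → GTerm G.sig} {k l N : ℕ} {W V : GTerm G.sig}
    {τ : ℕ → GTerm G.sig} (h1 : ∀ n < G.sig.arity A, τ n = ext c n)
    (h2 : ∀ i, ∀ l ≤ M, ∀ V, Reach G (c i) l V → ∃ n < N, τ n = V)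
    (hW : InstanceAt G A c k W) (hl : l ≤ M) (hr : Reach G W l V) :
    ∃ E ∈ nearPatterns G M N A k, V = subst τ E := by
  obtain ⟨E, hE, -, rfl⟩ := hW
  rcases hr.lift with ⟨E', hE', rfl⟩ | ⟨l', j, n, hle, hE', hr'⟩
  · have hP := hE.reach hE'
    exact ⟨E', Or.inl (hP.mono (by omega)), hP.onlyBelow _ _ fun n hn => (h1 n hn).symm⟩
  · have hn := (hE.reach hE').onlyBelow.var_lt
    rw [ext_of_lt c hn] at hr'
    obtain ⟨n', hn', rfl⟩ := h2 _ j (by omega) V hr'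
    exact ⟨var G.sig n', Or.inr ⟨n', hn', rfl⟩, (subst_var _ _).symm⟩

theorem Stage.exists_patterns {A : Fin G.sig.ntCount}
    {c : Fin (G.sig.arity A) → GTerm G.sig} {k N : ℕ} {W X Y : GTerm G.sig}
    {τ : ℕ → GTerm G.sig} (h1 : ∀ n < G.sig.arity A, τ n = ext c n)
    (h2 : ∀ i, ∀ l ≤ M, ∀ V, Reach G (c i) l V → ∃ n < N, τ n = V)
    (hW : InstanceAt G A c k W) (h : Stage G M W X Y) :
    ∃ E ∈ stagePatterns G M N A k, ∃ F ∈ stagePatterns G M N A k,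
      X = subst τ E ∧ Y = subst τ F := by
  obtain ⟨B, H, σ, hH, hσ, rfl, hY⟩ := h
  have hε : ∀ n, ∃ E ∈ nearPatterns G M N A k, σ n = subst τ E := by
    intro n
    obtain ⟨l, hl, hr⟩ := hσ n
    exact hW.exists_nearPattern h1 h2 hl hr
  choose ε hε1 hε2 using hε
  obtain ⟨F, hF, rfl⟩ := hW.exists_nearPattern h1 h2 le_rfl hY
  refine ⟨subst (ext fun i : Fin (G.sig.arity B) => ε i) H, Or.inr ?_, F, Or.inl hF, ?_, rfl⟩
  · exact Set.mem_iUnion.2 ⟨B, Set.mem_image2_of_mem (fun i => hε1 i) hH⟩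
  · rw [subst_subst]
    refine (onlyBelow_lhsTerm B).reach hH _ _ fun n hn => ?_
    rw [ext_of_lt _ hn, hε2]

theorem StageSymm.exists_patterns {A : Fin G.sig.ntCount}
    {c : Fin (G.sig.arity A) → GTerm G.sig} {k N : ℕ} {W X Y : GTerm G.sig}
    {τ : ℕ → GTerm G.sig} (h1 : ∀ n < G.sig.arity A, τ n = ext c n)
    (h2 : ∀ i, ∀ l ≤ M, ∀ V, Reach G (c i) l V → ∃ n < N, τ n = V)
    (hW : InstanceAt G A c k W) (h : StageSymm G M W X Y) :
    ∃ p ∈ stagePatterns G M N A k ×ˢ stagePatterns G M N A k,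
      X = subst τ p.1 ∧ Y = subst τ p.2 := by
  rcases h with h | h
  · obtain ⟨E, hE, F, hF, hX, hY⟩ := h.exists_patterns h1 h2 hW
    exact ⟨(E, F), ⟨hE, hF⟩, hX, hY⟩
  · obtain ⟨E, hE, F, hF, hY, hX⟩ := h.exists_patterns h1 h2 hW
    exact ⟨(F, E), ⟨hF, hE⟩, hX, hY⟩

/-- The patterns of the pairs that can occur in the successive balancing steps. -/
def pairPatterns (G : FOGrammar) (M ρ N : ℕ) (A : Fin G.sig.ntCount) (j : ℕ) :
    Set (GTerm G.sig × GTerm G.sig) :=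
  stagePatterns G M N A (linkIndex M ρ * (j + 1)) ×ˢ stagePatterns G M N A (linkIndex M ρ * (j + 1))

/-- The number of balancing steps at instances of patterns of one fixed term is bounded. -/
theorem exists_chain_bound (hB : Bounds G M ρ) :
    ∃ L, ∀ (A : Fin G.sig.ntCount) (c : Fin (G.sig.arity A) → GTerm G.sig),
      ∃ (P : ℕ → Set (GTerm G.sig × GTerm G.sig)) (τ : ℕ → GTerm G.sig),
        (∀ e, ¬ Long G τ P L e) ∧
        ∀ j W X Y, InstanceAt G A c (linkIndex M ρ * (j + 1)) W → StageSymm G M W X Y →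
          ∃ p ∈ P j, X = subst τ p.1 ∧ Y = subst τ p.2 := by
  obtain ⟨L, hL⟩ := exists_uniform (Set.finite_univ (α := Fin G.sig.ntCount))
    (Q := fun A L => ∀ c : Fin (G.sig.arity A) → GTerm G.sig,
      ∃ (P : ℕ → Set (GTerm G.sig × GTerm G.sig)) (τ : ℕ → GTerm G.sig),
        (∀ e, ¬ Long G τ P L e) ∧
        ∀ j W X Y, InstanceAt G A c (linkIndex M ρ * (j + 1)) W → StageSymm G M W X Y →
          ∃ p ∈ P j, X = subst τ p.1 ∧ Y = subst τ p.2)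
    (fun A m n hmn h c => by
      obtain ⟨P, τ, h1, h2⟩ := h c
      exact ⟨P, τ, fun e he => h1 e (he.anti hmn), h2⟩)
    (fun A _ => by
      obtain ⟨N, hN⟩ := exists_listing G M (G.sig.arity A)
      obtain ⟨L, hL⟩ := exists_long_bound (Finset.range N) (pairPatterns G M ρ N A)
        fun j => (stagePatterns_finite hB N A _).prod (stagePatterns_finite hB N A _)
      refine ⟨L, fun c => ?_⟩
      obtain ⟨τ, h1, h2, h3⟩ := hN c
      refine ⟨pairPatterns G M ρ N A, τ, hL τ fun n hn => h2 n ?_, fun j W X Y hW hst =>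
        hst.exists_patterns h1 h3 hW⟩
      rwa [Finset.mem_range, not_lt] at hn)
  exact ⟨L, fun A => hL A trivial⟩

theorem gap_mono {d d' : ℕ} (h : d ≤ d') : gap M ρ d ≤ gap M ρ d' :=
  Nat.add_le_add_left (Nat.mul_le_mul_left _ (by omega)) _

theorem eqLev_le_of_instanceAt (hB : Bounds G M ρ) {L : ℕ}
    (hL : ∀ (A : Fin G.sig.ntCount) (c : Fin (G.sig.arity A) → GTerm G.sig),
      ∃ (P : ℕ → Set (GTerm G.sig × GTerm G.sig)) (τ : ℕ → GTerm G.sig),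
        (∀ e, ¬ Long G τ P L e) ∧
        ∀ j W X Y, InstanceAt G A c (linkIndex M ρ * (j + 1)) W → StageSymm G M W X Y →
          ∃ p ∈ P j, X = subst τ p.1 ∧ Y = subst τ p.2)
    {h e : ℕ} {A : Fin G.sig.ntCount} {c : Fin (G.sig.arity A) → GTerm G.sig}
    {W X Y : GTerm G.sig} (hc : DepthLe h (app A c)) (hW : InstanceAt G A c (linkIndex M ρ) W)
    (hst : StageSymm G M W X Y) (hlev : EqLev G e X Y) :
    e ≤ h * (L * gap M ρ (1 + linkIndex M ρ * L * ρ + h)) := by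
  induction h generalizing e A c W X Y with
  | zero =>
    obtain ⟨d, hd, -⟩ := hc.app_inv
    omega
  | succ h ih =>
    obtain ⟨κ, hκ⟩ : ∃ κ, κ = gap M ρ (1 + linkIndex M ρ * L * ρ + (h + 1)) := ⟨_, rfl⟩
    obtain ⟨b, hb⟩ : ∃ b, b = h * (L * gap M ρ (1 + linkIndex M ρ * L * ρ + h)) := ⟨_, rfl⟩
    obtain ⟨P, τ, hlong, hP⟩ := hL A c
    have key : ∀ n j e W X Y, j + n = L → InstanceAt G A c (linkIndex M ρ * (j + 1)) W →
        StageSymm G M W X Y → EqLev G e X Y →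
        e ≤ n * κ + b ∨ Long G τ (fun i => P (i + j)) n (e + 1) := by
      intro n
      induction n with
      | zero => exact fun j e W X Y _ _ _ _ => Or.inr trivial
      | succ n ihn =>
        intro j e W X Y hj hW hst hlev
        rw [Nat.succ_mul]
        have hdW : DepthLe (1 + linkIndex M ρ * L * ρ + (h + 1)) W := by
          refine (hW.depthLe hB hc).mono (Nat.add_le_add_right (Nat.add_le_add_left
            (Nat.mul_le_mul_right _ (Nat.mul_le_mul_left _ (by omega))) _) _)
        rcases hst.next hB hlev hdW with hle | ⟨W', X', Y', e', hst', hlev', hlt, hle, hlink⟩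
        · left
          omega
        rw [← hκ] at hle
        rcases hlink.instanceAt hW hc (hst'.pivot_not_isVar hB) with hW' | ⟨B, d, hd, hW'⟩
        · rw [← Nat.mul_succ] at hW'
          rcases ihn (j + 1) e' W' X' Y' (by omega) hW' hst' hlev' with h1 | h1
          · left
            omega
          · right
            obtain ⟨p, hp, rfl, rfl⟩ := hP j W X Y hW hst
            refine ⟨p, by simpa only [Nat.zero_add] using hp, e, by omega, hlev, ?_⟩
            refine Long.mono ?_ (show e' + 1 ≤ e by omega)
            convert h1 using 3
            omega
        · left
          have := ih hd hW' hst' hlev'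
          omega
    rcases key L 0 e W X Y (Nat.zero_add L) (by rwa [Nat.zero_add, Nat.mul_one]) hst hlev with
      h1 | h1
    · have hbb : b ≤ h * (L * κ) := by
        rw [hb, hκ]
        exact Nat.mul_le_mul_left _ (Nat.mul_le_mul_left _ (gap_mono (by omega)))
      rw [← hκ, Nat.succ_mul]
      omega
    · exact absurd h1 (hlong _)

/-- Finite equivalence levels of terms are bounded by a primitive recursive function of the
depth. -/
theorem exists_eqLev_bound_of_depthLe (G : FOGrammar) :
    ∃ b : ℕ → ℕ, Primrec b ∧ ∀ (d e : ℕ) (X Y : GTerm G.sig), DepthLe d X → DepthLe d Y →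
      EqLev G e X Y → e ≤ b d := by
  obtain ⟨M, ρ, hB⟩ := exists_bounds G
  obtain ⟨L, hL⟩ := exists_chain_bound hB
  refine ⟨fun d => M * (d + 1) + d * (L * gap M ρ (1 + linkIndex M ρ * L * ρ + d)), ?_, ?_⟩
  · have hgap : Primrec (gap M ρ) := by
      unfold gap
      refine Primrec.nat_add.comp (Primrec.const _) (Primrec.nat_mul.comp (Primrec.const _) ?_)
      exact Primrec.succ.comp (Primrec.nat_add.comp Primrec.id (Primrec.const _))
    refine Primrec.nat_add.comp (Primrec.nat_mul.comp (Primrec.const _) Primrec.succ)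
      (Primrec.nat_mul.comp Primrec.id (Primrec.nat_mul.comp (Primrec.const _) (hgap.comp
        (Primrec.nat_add.comp (Primrec.const _) Primrec.id))))
  · intro d e X Y hX hY h
    change e ≤ M * (d + 1) + d * (L * gap M ρ (1 + linkIndex M ρ * L * ρ + d))
    rcases h.next_of_depthLe hB hX hY with hle | ⟨W, X', Y', e', hst, hlev, hlt, hle, Z, hZ, l,
      hl, hr⟩
    · omega
    · have hdZ : DepthLe d Z := hZ.elim hX.subterm hY.subterm
      obtain ⟨B, c, hc, hW⟩ := hdZ.instanceAt_of_reach hr (hst.pivot_not_isVar hB)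
      have hidx : linkIndex M ρ = linkLength M ρ + M := rfl
      have := eqLev_le_of_instanceAt hB hL hc (hW.mono (by omega)) hst hlev
      omega

end Patterns

section EqLevel

variable {G : FOGrammar}

open GTerm

theorem eqlevel_eq_top_of_sim {T U : GTerm G.sig} (h : ∀ k, Sim G k T U) :
    (LTSact G).eqlevel T U = ⊤ :=
  ENat.eq_top_iff_forall_ge.2 fun k => le_sSup ⟨k, rfl, h k⟩

theorem EqLev.eqlevel_eq {e : ℕ} {T U : GTerm G.sig} (h : EqLev G e T U) :
    (LTSact G).eqlevel T U = e := by
  refine IsGreatest.csSup_eq ⟨⟨e, rfl, h.1⟩, ?_⟩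
  rintro _ ⟨k, rfl, hk⟩
  refine Nat.cast_le.2 ?_
  by_contra hlt
  exact h.2 (Sim.mono (by omega) hk)

theorem sim_of_bisim {T U : GTerm G.sig} (h : (LTSact G).Bisim T U) (k : ℕ) : Sim G k T U := by
  obtain ⟨B, hB, hTU⟩ := h
  induction k generalizing T U with
  | zero => exact sim_zero _ _
  | succ k ih =>
    refine sim_succ_raw.2 ⟨fun a s hs => ?_, fun a s hs => ?_⟩
    · obtain ⟨t, ht, h⟩ := (hB _ hTU).1 a s hs
      exact ⟨t, ht, ih h⟩
    · obtain ⟨t, ht, h⟩ := (hB _ hTU).2 a s hs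
      exact ⟨t, ht, ih h⟩

theorem exists_stepA_forall_sim {a : Fin G.sig.actCount} {T' U : GTerm G.sig}
    (h : ∀ k, ∃ U', StepA G a U U' ∧ Sim G k T' U') :
    ∃ U', StepA G a U U' ∧ ∀ k, Sim G k T' U' := by
  by_contra! hcon
  have hfin : {U' | StepA G a U U'}.Finite := (Step.finite U).subset fun U' hU' => ⟨a, hU'⟩
  obtain ⟨n, hn⟩ := exists_uniform hfin (Q := fun U' n => ¬ Sim G n T' U')
    (fun _ _ _ hle hm hs => hm (hs.mono hle)) hcon
  obtain ⟨U', hU', hs⟩ := h n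
  exact hn U' hU' hs

theorem bisim_iff_forall_sim {T U : GTerm G.sig} :
    (LTSact G).Bisim T U ↔ ∀ k, Sim G k T U := by
  refine ⟨sim_of_bisim, fun h => ⟨{p | ∀ k, Sim G k p.1 p.2}, ?_, h⟩⟩
  rintro ⟨T, U⟩ (hp : ∀ k, Sim G k T U)
  refine ⟨?_, ?_⟩
  · rintro (a | n) T' hT
    · obtain ⟨U', hU', hs⟩ := exists_stepA_forall_sim fun k =>
        (sim_succ_iff.1 (hp (k + 1))).1 a T' ((LTSact_inl_iff G a T T').1 hT)
      exact ⟨U', (LTSact_inl_iff G a U U').2 hU', hs⟩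
    · obtain ⟨hT', rfl⟩ := (LTSact_inr_iff G n T T').1 hT
      exact ⟨_, (LTSact_inr_iff G n U _).2 ⟨((sim_succ_iff.1 (hp 1)).2.2 n).1 hT', rfl⟩,
        fun k => Sim.refl k _⟩
  · rintro (a | n) U' hU
    · have hq : ∀ k, ∃ T', StepA G a T T' ∧ Sim G k U' T' := fun k => by
        obtain ⟨T', hT', hs⟩ :=
          (sim_succ_iff.1 (hp (k + 1))).2.1 a U' ((LTSact_inl_iff G a U U').1 hU)
        exact ⟨T', hT', hs.symm⟩
      obtain ⟨T', hT', hs⟩ := exists_stepA_forall_sim hq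
      exact ⟨T', (LTSact_inl_iff G a T T').2 hT', fun k => (hs k).symm⟩
    · obtain ⟨hU', rfl⟩ := (LTSact_inr_iff G n U U').1 hU
      exact ⟨_, (LTSact_inr_iff G n T _).2 ⟨((sim_succ_iff.1 (hp 1)).2.2 n).2 hU', rfl⟩,
        fun k => Sim.refl k _⟩

end EqLevel

namespace FTerm

variable {S : GrammarSig}

theorem enc_injective : Function.Injective (enc (S := S)) := by
  intro T
  induction T with
  | var n =>
    rintro (m | ⟨B, d⟩) h
    · simp only [enc, Nat.pair_eq_pair, true_and] at h
      rw [h]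
    · simp [enc, Nat.pair_eq_pair] at h
  | app A c ih =>
    rintro (m | ⟨B, d⟩) h
    · simp [enc, Nat.pair_eq_pair] at h
    · simp only [enc, Nat.pair_eq_pair, true_and] at h
      obtain ⟨hA, h⟩ := h
      obtain rfl := Fin.ext hA
      have h' := List.ofFn_injective (Encodable.encode_injective h)
      rw [funext fun i => ih i (congrFun h' i)]

theorem lt_encode_of_mem {l : List ℕ} {a : ℕ} (h : a ∈ l) : a < Encodable.encode l := by
  induction l with
  | nil => cases h
  | cons b l ih =>
    rw [Encodable.encode_list_cons]
    rcases List.mem_cons.1 h with rfl | h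
    · exact Nat.lt_succ_of_le (Nat.left_le_pair _ _)
    · exact (ih h).trans (Nat.lt_succ_of_le (Nat.right_le_pair _ _))

theorem enc_child_lt (A : Fin S.ntCount) (c : Fin (S.arity A) → FTerm S) (i) :
    (c i).enc < (app A c).enc :=
  (lt_encode_of_mem (List.mem_ofFn.2 ⟨i, rfl⟩ : (c i).enc ∈ List.ofFn fun i => (c i).enc)).trans_le
    ((Nat.right_le_pair _ _).trans (Nat.right_le_pair _ _))

theorem depthLe_enc (T : FTerm S) : DepthLe T.enc T.toTerm := by
  induction T with
  | var n => exact Barred.var _ n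
  | app A c ih =>
    have hpos : 1 ≤ (app A c).enc := Nat.left_le_pair 1 _
    rw [← Nat.sub_add_cancel hpos]
    exact Barred.app A _ fun i => (ih i).mono (Nat.le_sub_one_of_lt (enc_child_lt A c i))

/-- Simultaneous substitution of finite terms for variables. -/
def bind (σ : ℕ → FTerm S) : FTerm S → FTerm S
  | .var n => σ n
  | .app A c => .app A fun i => (c i).bind σ

theorem toTerm_bind (σ : ℕ → FTerm S) (E : FTerm S) :
    (E.bind σ).toTerm = GTerm.subst (fun n => (σ n).toTerm) E.toTerm := by
  induction E with
  | var n => simp only [bind, toTerm, GTerm.subst_var]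
  | app A c ih => simp only [bind, toTerm, GTerm.subst_app, ih]

/-- The code of a substitution instance, computed from the list of the codes of the terms
substituted for the variables. -/
def bindCode : FTerm S → List ℕ → ℕ
  | .var n, l => l.getD n 0
  | .app A c, l =>
    Nat.pair 1 (Nat.pair A.val (Encodable.encode (List.ofFn fun i => (c i).bindCode l)))

theorem bindCode_eq {l : List ℕ} {σ : ℕ → FTerm S} (E : FTerm S)
    (h : ∀ n, E.VOccurs n → l.getD n 0 = (σ n).enc) : E.bindCode l = (E.bind σ).enc := by
  induction E with
  | var n => exact h n rfl
  | app A c ih =>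
    simp only [bindCode, bind, enc]
    simp only [fun i => ih i fun n hn => h n ⟨i, hn⟩]

theorem primrec_bindCode (E : FTerm S) : Primrec E.bindCode := by
  induction E with
  | var n => exact (Primrec.list_getD 0).comp Primrec.id (Primrec.const n)
  | app A c ih =>
    exact Primrec₂.natPair.comp (Primrec.const 1) (Primrec₂.natPair.comp (Primrec.const A.val)
      (Primrec.encode.comp (Primrec.list_ofFn ih)))

/-- The codes of the children of a term, computed from the code of the term. -/
def childCodes (n : ℕ) : List ℕ :=
  (Encodable.decode (α := List ℕ) n.unpair.2.unpair.2).getD []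

theorem childCodes_enc (A : Fin S.ntCount) (c : Fin (S.arity A) → FTerm S) :
    childCodes (app A c).enc = List.ofFn fun i => (c i).enc := by
  simp only [childCodes, enc, Nat.unpair_pair, Encodable.encodek, Option.getD_some]

theorem primrec_childCodes : Primrec childCodes :=
  Primrec.option_getD.comp
    (Primrec.decode.comp (Primrec.snd.comp (Primrec.unpair.comp
      (Primrec.snd.comp Primrec.unpair)))) (Primrec.const [])

/-- The substitution given by the children of a finite term. -/
def childSubst : FTerm S → ℕ → FTerm S
  | .var _, n => .var n
  | .app A c, n => if h : n < S.arity A then c ⟨n, h⟩ else .var n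

end FTerm

namespace GRule

variable {S : GrammarSig}

/-- The rule applies to the term with the given code. -/
def AppliesCode (r : GRule S) (n : ℕ) : Prop :=
  n.unpair.1 = 1 ∧ n.unpair.2.unpair.1 = r.nt.val

/-- The code of the result of applying the rule to the term with the given code. -/
def applyCode (r : GRule S) (n : ℕ) : ℕ := r.rhs.bindCode (FTerm.childCodes n)

/-- The result of applying the rule to a finite term. -/
def apply (r : GRule S) (T : FTerm S) : FTerm S := r.rhs.bind T.childSubst

theorem appliesCode_enc_iff (r : GRule S) (T : FTerm S) :
    r.AppliesCode T.enc ↔ ∃ c, T = .app r.nt c := by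
  cases T with
  | var n => simp [AppliesCode, FTerm.enc]
  | app A c =>
    simp only [AppliesCode, FTerm.enc, Nat.unpair_pair, true_and]
    constructor
    · intro h
      obtain rfl := Fin.ext h
      exact ⟨c, rfl⟩
    · rintro ⟨d, h⟩
      cases h
      rfl

theorem applyCode_enc (r : GRule S) {T : FTerm S} (h : r.AppliesCode T.enc) :
    r.applyCode T.enc = (r.apply T).enc := by
  obtain ⟨c, rfl⟩ := (r.appliesCode_enc_iff T).1 h
  refine FTerm.bindCode_eq _ fun n hn => ?_
  have hlt := r.rhs_wf n hn
  rw [FTerm.childCodes_enc]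
  simp [FTerm.childSubst, hlt, List.getD_eq_getElem?_getD]

theorem toTerm_apply (r : GRule S) (c : Fin (S.arity r.nt) → FTerm S) :
    (r.apply (.app r.nt c)).toTerm =
      GTerm.subst (GTerm.ext fun i => (c i).toTerm) r.rhs.toTerm := by
  rw [apply, FTerm.toTerm_bind]
  refine GTerm.subst_toTerm_congr _ fun n hn => ?_
  have hlt := r.rhs_wf n hn
  simp [FTerm.childSubst, hlt, GTerm.ext]

theorem primrecPred_appliesCode (r : GRule S) : PrimrecPred r.AppliesCode :=
  (Primrec.eq.comp (Primrec.fst.comp Primrec.unpair) (Primrec.const 1)).and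
    (Primrec.eq.comp (Primrec.fst.comp (Primrec.unpair.comp (Primrec.snd.comp Primrec.unpair)))
      (Primrec.const r.nt.val))

theorem primrec_applyCode (r : GRule S) : Primrec r.applyCode :=
  (FTerm.primrec_bindCode r.rhs).comp FTerm.primrec_childCodes

end GRule

section SimCode

variable {G : FOGrammar}

theorem stepA_toTerm_iff {a : Fin G.sig.actCount} {T : FTerm G.sig} {X : GTerm G.sig} :
    StepA G a T.toTerm X ↔ ∃ i : Fin G.rules.length, (G.rules.get i).act = a ∧
      (G.rules.get i).AppliesCode T.enc ∧ X = ((G.rules.get i).apply T).toTerm := by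
  constructor
  · rintro ⟨r, hr, ha, c, hT, rfl⟩
    obtain ⟨i, rfl⟩ := List.mem_iff_get.1 hr
    cases T with
    | var n => exact absurd hT GTerm.var_ne_app
    | app A d =>
      obtain rfl := GTerm.app_nt_inj hT
      obtain rfl := GTerm.app_inj.1 hT
      exact ⟨i, ha, (GRule.appliesCode_enc_iff _ _).2 ⟨d, rfl⟩, (GRule.toTerm_apply _ d).symm⟩
  · rintro ⟨i, ha, hc, rfl⟩
    obtain ⟨c, rfl⟩ := (GRule.appliesCode_enc_iff _ _).1 hc
    exact ⟨_, List.get_mem _ _, ha, _, rfl, GRule.toTerm_apply _ c⟩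

/-- The condition on the codes of two terms for being covered by a relation between the results of
applying the `i`-th rule to the first term and the `j`-th rule to the second one. -/
def CoverCode (G : FOGrammar) (t u : ℕ) (Q : Fin G.rules.length → Fin G.rules.length → Prop) :
    Prop :=
  (∀ i, ¬ (G.rules.get i).AppliesCode t ∨ ∃ j, ((G.rules.get j).act = (G.rules.get i).act ∧
    (G.rules.get j).AppliesCode u) ∧ Q i j) ∧
  (∀ j, ¬ (G.rules.get j).AppliesCode u ∨ ∃ i, ((G.rules.get i).act = (G.rules.get j).act ∧
    (G.rules.get i).AppliesCode t) ∧ Q i j) ∧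
  (t = u ∨ (t.unpair.1 ≠ 0 ∧ u.unpair.1 ≠ 0))

/-- The relation `∼_k` on codes of finite terms. -/
def SimCode (G : FOGrammar) : ℕ → ℕ → ℕ → Prop
  | 0, _, _ => True
  | k + 1, t, u => CoverCode G t u fun i j =>
      SimCode G k ((G.rules.get i).applyCode t) ((G.rules.get j).applyCode u)

theorem forall_var_iff {T U : FTerm G.sig} :
    (∀ n, T.toTerm = GTerm.var G.sig n ↔ U.toTerm = GTerm.var G.sig n) ↔
      (T.enc = U.enc ∨ (T.enc.unpair.1 ≠ 0 ∧ U.enc.unpair.1 ≠ 0)) := by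
  rw [FTerm.enc_injective.eq_iff]
  cases T with
  | var n =>
    cases U with
    | var m =>
      simp only [FTerm.toTerm, GTerm.var_inj, FTerm.enc, Nat.unpair_pair, FTerm.var.injEq]
      constructor
      · intro h
        exact Or.inl ((h m).2 rfl)
      · rintro (rfl | h)
        · exact fun _ => Iff.rfl
        · exact absurd rfl h.1
    | app B d =>
      simp only [FTerm.toTerm, GTerm.var_inj, FTerm.enc, Nat.unpair_pair, GTerm.app_ne_var]
      simp
  | app A c =>
    cases U with
    | var m =>
      simp only [FTerm.toTerm, GTerm.var_inj, FTerm.enc, Nat.unpair_pair, GTerm.app_ne_var]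
      simp
    | app B d =>
      simp [FTerm.toTerm, FTerm.enc, GTerm.app_ne_var]

theorem simCode_enc_iff {k : ℕ} {T U : FTerm G.sig} :
    SimCode G k T.enc U.enc ↔ Sim G k T.toTerm U.toTerm := by
  induction k generalizing T U with
  | zero => exact ⟨fun _ => sim_zero _ _, fun _ => trivial⟩
  | succ k ih =>
    rw [sim_succ_iff, forall_var_iff]
    refine and_congr ?_ (and_congr ?_ Iff.rfl)
    · constructor
      · intro h a T' hT
        obtain ⟨i, ha, hi, rfl⟩ := stepA_toTerm_iff.1 hT
        obtain ⟨j, ⟨hji, hj⟩, hs⟩ := (h i).resolve_left (not_not.2 hi)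
        rw [GRule.applyCode_enc _ hi, GRule.applyCode_enc _ hj, ih] at hs
        exact ⟨_, stepA_toTerm_iff.2 ⟨j, hji.trans ha, hj, rfl⟩, hs⟩
      · intro h i
        refine or_iff_not_imp_left.2 fun hi => ?_
        have hi := not_not.1 hi
        obtain ⟨U', hU, hs⟩ := h _ _ (stepA_toTerm_iff.2 ⟨i, rfl, hi, rfl⟩)
        obtain ⟨j, ha, hj, rfl⟩ := stepA_toTerm_iff.1 hU
        refine ⟨j, ⟨ha, hj⟩, ?_⟩
        beta_reduce
        rwa [GRule.applyCode_enc _ hi, GRule.applyCode_enc _ hj, ih]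
    · constructor
      · intro h a U' hU
        obtain ⟨j, ha, hj, rfl⟩ := stepA_toTerm_iff.1 hU
        obtain ⟨i, ⟨hij, hi⟩, hs⟩ := (h j).resolve_left (not_not.2 hj)
        rw [GRule.applyCode_enc _ hi, GRule.applyCode_enc _ hj, ih] at hs
        exact ⟨_, stepA_toTerm_iff.2 ⟨i, hij.trans ha, hi, rfl⟩, hs⟩
      · intro h j
        refine or_iff_not_imp_left.2 fun hj => ?_
        have hj := not_not.1 hj
        obtain ⟨T', hT, hs⟩ := h _ _ (stepA_toTerm_iff.2 ⟨j, rfl, hj, rfl⟩)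
        obtain ⟨i, ha, hi, rfl⟩ := stepA_toTerm_iff.1 hT
        refine ⟨i, ⟨ha, hi⟩, ?_⟩
        beta_reduce
        rwa [GRule.applyCode_enc _ hi, GRule.applyCode_enc _ hj, ih]

theorem PrimrecPred.const {α : Type*} [Primcodable α] (p : Prop) :
    PrimrecPred fun _ : α => p := by
  classical
  exact ⟨fun _ => inferInstance, Primrec.const _⟩

theorem PrimrecPred.forall_fin {α : Type*} [Primcodable α] {n : ℕ} {p : Fin n → α → Prop}
    (h : ∀ i, PrimrecPred (p i)) : PrimrecPred fun a => ∀ i, p i a := by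
  induction n with
  | zero => exact (PrimrecPred.const True).of_eq fun a => by simp
  | succ n ih =>
    exact ((h 0).and (ih fun i => h i.succ)).of_eq fun a => (Fin.forall_fin_succ (P := fun i => p i a)).symm

theorem PrimrecPred.exists_fin {α : Type*} [Primcodable α] {n : ℕ} {p : Fin n → α → Prop}
    (h : ∀ i, PrimrecPred (p i)) : PrimrecPred fun a => ∃ i, p i a := by
  induction n with
  | zero => exact (PrimrecPred.const False).of_eq fun a => by simp
  | succ n ih =>
    exact ((h 0).or (ih fun i => h i.succ)).of_eq fun a => (Fin.exists_fin_succ (P := fun i => p i a)).symm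

theorem primrecPred_coverCode {α : Type*} [Primcodable α] {t u : α → ℕ}
    {Q : Fin G.rules.length → Fin G.rules.length → α → Prop} (ht : Primrec t) (hu : Primrec u)
    (hQ : ∀ i j, PrimrecPred (Q i j)) :
    PrimrecPred fun a => CoverCode G (t a) (u a) fun i j => Q i j a := by
  refine PrimrecPred.and ?_ (PrimrecPred.and ?_ ?_)
  · exact PrimrecPred.forall_fin fun i => (((GRule.primrecPred_appliesCode _).comp ht).not).or
      (PrimrecPred.exists_fin fun j => ((PrimrecPred.const _).and
        ((GRule.primrecPred_appliesCode _).comp hu)).and (hQ i j))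
  · exact PrimrecPred.forall_fin fun j => (((GRule.primrecPred_appliesCode _).comp hu).not).or
      (PrimrecPred.exists_fin fun i => ((PrimrecPred.const _).and
        ((GRule.primrecPred_appliesCode _).comp ht)).and (hQ i j))
  · exact (Primrec.eq.comp ht hu).or
      ((Primrec.eq.comp (Primrec.fst.comp (Primrec.unpair.comp ht)) (Primrec.const 0)).not.and
        (Primrec.eq.comp (Primrec.fst.comp (Primrec.unpair.comp hu)) (Primrec.const 0)).not)

/-- The queries that `SimCode` makes recursively. -/
def simQueries (G : FOGrammar) (p : ℕ × ℕ × ℕ) : List (ℕ × ℕ × ℕ) :=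
  List.ofFn fun q : Fin (G.rules.length * G.rules.length) =>
    (p.1 - 1, (G.rules.get (finProdFinEquiv.symm q).1).applyCode p.2.1,
      (G.rules.get (finProdFinEquiv.symm q).2).applyCode p.2.2)

theorem primrec_simQueries : Primrec (simQueries G) :=
  Primrec.list_ofFn fun _ => (Primrec.pred.comp Primrec.fst).pair
    (((GRule.primrec_applyCode _).comp (Primrec.fst.comp Primrec.snd)).pair
      ((GRule.primrec_applyCode _).comp (Primrec.snd.comp Primrec.snd)))

theorem simQueries_getD {f : ℕ × ℕ × ℕ → Bool} (p : ℕ × ℕ × ℕ) (i j : Fin G.rules.length) :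
    ((simQueries G p).map f).getD (finProdFinEquiv (i, j)) false =
      f (p.1 - 1, (G.rules.get i).applyCode p.2.1, (G.rules.get j).applyCode p.2.2) := by
  rw [List.getD_eq_getElem _ _ (by simp only [simQueries, List.length_map, List.length_ofFn,
    Fin.is_lt])]
  simp only [simQueries, List.getElem_map, List.getElem_ofFn, Fin.eta, Equiv.symm_apply_apply]

theorem primrecPred_simCode :
    PrimrecPred fun p : ℕ × ℕ × ℕ => SimCode G p.1 p.2.1 p.2.2 := by
  classical
  refine ⟨inferInstance, ?_⟩
  have hcover : PrimrecPred fun x : (ℕ × ℕ × ℕ) × List Bool =>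
      x.1.1 = 0 ∨ CoverCode G x.1.2.1 x.1.2.2 fun i j =>
        x.2.getD (finProdFinEquiv (i, j)) false = true :=
    (Primrec.eq.comp (Primrec.fst.comp Primrec.fst) (Primrec.const 0)).or
      (primrecPred_coverCode (Primrec.fst.comp (Primrec.snd.comp Primrec.fst))
        (Primrec.snd.comp (Primrec.snd.comp Primrec.fst)) fun i j =>
        Primrec.eq.comp ((Primrec.list_getD false).comp Primrec.snd (Primrec.const _))
          (Primrec.const true))
  refine Primrec.nat_omega_rec' (m := Prod.fst)
    (l := fun p => if p.1 = 0 then [] else simQueries G p)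
    (g := fun p l => some (decide (p.1 = 0 ∨ CoverCode G p.2.1 p.2.2 fun i j =>
        l.getD (finProdFinEquiv (i, j)) false = true)))
    _ Primrec.fst
    (Primrec.ite (Primrec.eq.comp Primrec.fst (Primrec.const 0)) (Primrec.const [])
      primrec_simQueries)
    (Primrec.option_some.comp hcover.decide) ?_ ?_
  · rintro ⟨k, t, u⟩ p hp
    cases k with
    | zero => simp at hp
    | succ k =>
      simp only [Nat.succ_ne_zero, if_false, simQueries, List.mem_ofFn] at hp
      obtain ⟨q, rfl⟩ := hp
      simp
  · rintro ⟨k, t, u⟩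
    cases k with
    | zero => exact congrArg some (decide_eq_decide.2 (iff_of_true (Or.inl rfl) trivial))
    | succ k =>
      refine congrArg some (decide_eq_decide.2 ?_)
      simp only [Nat.succ_ne_zero, if_false, simQueries_getD, decide_eq_true_eq, false_or, SimCode,
        Nat.add_sub_cancel]

end SimCode

/-- there is a total computable function which, on (the codes of) a pair
`(T₀,U₀)` of finite terms over `N`, returns `eqlevel(T₀,U₀) ∈ ℕ ∪ {ω}` computed in
`L^act_G`, where the value `ω` is encoded by `0` and a finite value `e` by `e + 1`.
In particular, bisimulation equivalence of finite terms over `N` is decidable. -/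
theorem eqlevel_computable (G : FOGrammar) :
    ∃ f : ℕ → ℕ, Computable f ∧ ∀ T U : FTerm G.sig,
      (((LTSact G).eqlevel T.toTerm U.toTerm = ⊤ ∧ f (Nat.pair T.enc U.enc) = 0) ∨
        (∃ e : ℕ, (LTSact G).eqlevel T.toTerm U.toTerm = (e : ℕ∞) ∧
          f (Nat.pair T.enc U.enc) = e + 1)) ∧
      (f (Nat.pair T.enc U.enc) = 0 ↔ (LTSact G).Bisim T.toTerm U.toTerm) := by
  classical
  obtain ⟨b, hbp, hb⟩ := exists_eqLev_bound_of_depthLe G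
  have hsim := primrecPred_simCode (G := G)
  let B : ℕ → ℕ := fun n => b (n.unpair.1 + n.unpair.2) + 1
  have hB : Primrec B := Primrec.succ.comp (hbp.comp (Primrec.nat_add.comp
    (Primrec.fst.comp Primrec.unpair) (Primrec.snd.comp Primrec.unpair)))
  let f : ℕ → ℕ := fun n => if SimCode G (B n) n.unpair.1 n.unpair.2 then 0 else
    Nat.rec 0 (fun k c => if SimCode G k n.unpair.1 n.unpair.2 then k + 1 else c) (B n)
  have hstep : Primrec₂ fun (n : ℕ) (p : ℕ × ℕ) =>
      if SimCode G p.1 n.unpair.1 n.unpair.2 then p.1 + 1 else p.2 :=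
    Primrec.ite (c := fun p : ℕ × ℕ × ℕ => SimCode G p.2.1 p.1.unpair.1 p.1.unpair.2)
      (hsim.comp ((Primrec.fst.comp Primrec.snd).pair (Primrec.unpair.comp Primrec.fst)))
      (Primrec.succ.comp (Primrec.fst.comp Primrec.snd)) (Primrec.snd.comp Primrec.snd)
  have hf : Primrec f := Primrec.ite (hsim.comp (hB.pair Primrec.unpair)) (Primrec.const 0)
    (Primrec.nat_rec' hB (Primrec.const 0) hstep)
  refine ⟨f, hf.to_comp, fun T U => ?_⟩
  have hbound : ∀ e, EqLev G e T.toTerm U.toTerm → e < B (Nat.pair T.enc U.enc) := fun e he => by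
    simp only [B, Nat.unpair_pair]
    exact Nat.lt_succ_of_le (hb _ e _ _ (T.depthLe_enc.mono (Nat.le_add_right _ _))
      (U.depthLe_enc.mono (Nat.le_add_left _ _)) he)
  by_cases h : ∀ k, Sim G k T.toTerm U.toTerm
  · have h0 : f (Nat.pair T.enc U.enc) = 0 := by
      simp only [f, Nat.unpair_pair, simCode_enc_iff]
      exact if_pos (h _)
    exact ⟨Or.inl ⟨eqlevel_eq_top_of_sim h, h0⟩, iff_of_true h0 (bisim_iff_forall_sim.2 h)⟩
  · obtain ⟨k, hk⟩ := not_forall.1 h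
    obtain ⟨e, he⟩ := exists_eqLev hk
    have hlt := hbound e he
    have hs : ∀ k, Sim G k T.toTerm U.toTerm ↔ k ≤ e := fun k =>
      ⟨fun hk => by
        by_contra hlt
        exact he.2 (hk.mono (by omega)), fun hk => he.1.mono hk⟩
    have hrec : ∀ n, e < n →
        (Nat.rec 0 (fun k c => if k ≤ e then k + 1 else c) n : ℕ) = e + 1 := fun n hn => by
      induction n, hn using Nat.le_induction with
      | base =>
        change (if e ≤ e then e + 1 else _) = _
        exact if_pos le_rfl
      | succ n hn ih =>
        change (if n ≤ e then n + 1 else _) = _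
        rw [if_neg (by omega), ih]
    have h1 : f (Nat.pair T.enc U.enc) = e + 1 := by
      simp only [f, Nat.unpair_pair, simCode_enc_iff, hs]
      rw [if_neg (by omega), hrec _ hlt]
    refine ⟨Or.inr ⟨e, he.eqlevel_eq, h1⟩, iff_of_false (by omega) ?_⟩
    exact fun hbis => h (bisim_iff_forall_sim.1 hbis)
end
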